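/- arXiv:2303.04152 — 2 statements merged into one kernel-verified Lean document; each statement's English description precedes it below -/
import Mathlib

section
/- For every integer n ≥ 1, the bipartite achievement number of the disjoint union of an edge and an n-edge matching satisfies ba(K_{1,1} ∪ nK_2) = n + 2 if n = 1 or n = 2, and ba(K_{1,1} ∪ nK_2) = n + 1 if n ≥ 3. -/
namespace AchievementGame

/-- A strategy for the achievement game: given the history of all moves played so far
(earliest first), produce the next move (an edge, i.e. an element of `Sym2`). -/
def Strategy (α : Type*) : Type _ := List (Sym2 α) → Sym2 α

/-- A strategy is valid for the host graph `G` if, whenever some edge of `G` is still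
uncolored, it chooses an uncolored edge of `G`. -/
def Strategy.Valid {α : Type*} (G : SimpleGraph α) (s : Strategy α) : Prop :=
  ∀ l : List (Sym2 α), (∃ e ∈ G.edgeSet, e ∉ l) → s l ∈ G.edgeSet ∧ s l ∉ l

/-- The history of the first `n` moves when Alice plays strategy `σ` and Bob plays
strategy `τ`; Alice moves first and the players alternate. -/
def hist {α : Type*} (σ τ : Strategy α) : ℕ → List (Sym2 α)
  | 0 => []
  | n + 1 => hist σ τ n ++ [(if n % 2 = 0 then σ else τ) (hist σ τ n)]

/-- The `n`-th move (0-indexed): even indices are Alice's (blue) moves,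
odd indices are Bob's (red) moves. -/
def move {α : Type*} (σ τ : Strategy α) (n : ℕ) : Sym2 α :=
  (if n % 2 = 0 then σ else τ) (hist σ τ n)

/-- The set `s` of edges contains a copy of the graph `F`. -/
def HasCopy {α β : Type*} (F : SimpleGraph β) (s : Set (Sym2 α)) : Prop :=
  ∃ f : β ↪ α, ∀ a b, F.Adj a b → s(f a, f b) ∈ s

/-- Alice has a winning strategy in the achievement game `(F, G, +)`: Alice has a valid
strategy such that against every valid strategy of Bob, at some legal move of Alice
(her `(k+1)`-st move, which exists since `2k+1 ≤ |E(G)|`) the blue edges contain a copy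
of `F`, while the red edges played strictly before do not. -/
def AliceWins {α β : Type*} (F : SimpleGraph β) (G : SimpleGraph α) : Prop :=
  ∃ σ : Strategy α, Strategy.Valid G σ ∧ ∀ τ : Strategy α, Strategy.Valid G τ →
    ∃ k : ℕ, 2 * k + 1 ≤ G.edgeSet.ncard ∧
      HasCopy F {e | ∃ i ≤ k, e = move σ τ (2 * i)} ∧
      ¬ HasCopy F {e | ∃ i < k, e = move σ τ (2 * i + 1)}

/-- The matching `mK₂` consisting of `m` pairwise disjoint edges. -/
def matching (m : ℕ) : SimpleGraph (Fin m ⊕ Fin m) :=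
  SimpleGraph.fromRel (fun a b => ∃ i, a = Sum.inl i ∧ b = Sum.inr i)

/-- The star `K_{1,m}`: the center `0` joined to `m` leaves. -/
def star (m : ℕ) : SimpleGraph (Fin (m + 1)) :=
  SimpleGraph.fromRel (fun a _ => a = 0)

/-- The double star `S_{m,n}`: disjoint stars `K_{1,m}` and `K_{1,n}` with an edge
joining their centers `Sum.inl 0` and `Sum.inr 0`. -/
def doubleStar (m n : ℕ) : SimpleGraph (Fin (m + 1) ⊕ Fin (n + 1)) :=
  SimpleGraph.fromRel (fun a b =>
    (a = Sum.inl 0 ∧ ∃ i, b = Sum.inl i) ∨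
    (a = Sum.inr 0 ∧ ∃ j, b = Sum.inr j) ∨
    (a = Sum.inl 0 ∧ b = Sum.inr 0))

/-- The disjoint union `K_{1,m} ∪ nK₂` of a star and a matching. -/
def starMatching (m n : ℕ) : SimpleGraph (Fin (m + 1) ⊕ (Fin n ⊕ Fin n)) :=
  SimpleGraph.fromRel (fun a b =>
    (a = Sum.inl 0 ∧ ∃ i, b = Sum.inl i) ∨
    (∃ i, a = Sum.inr (Sum.inl i) ∧ b = Sum.inr (Sum.inr i)))

end AchievementGame

open AchievementGame

namespace AGProof

/-- The game in terms of pairs: a matching of size `m`. -/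
def HasM (m N : ℕ) (B : Finset (Fin N × Fin N)) : Prop :=
  ∃ f g : Fin m → Fin N, Function.Injective f ∧ Function.Injective g ∧ ∀ i, (f i, g i) ∈ B

/-- Winning positions for Alice (Alice to move). -/
inductive W (m N : ℕ) : Finset (Fin N × Fin N) → Finset (Fin N × Fin N) → Prop
  | win {B R : Finset (Fin N × Fin N)} (e : Fin N × Fin N) (h1 : e ∉ B) (h2 : e ∉ R)
      (h3 : HasM m N (insert e B)) (h4 : ¬ HasM m N R) : W m N B R
  | step {B R : Finset (Fin N × Fin N)} (e f0 : Fin N × Fin N) (h1 : e ∉ B) (h2 : e ∉ R)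
      (h3 : f0 ∉ insert e B) (h4 : f0 ∉ R)
      (h5 : ∀ f, f ∉ insert e B → f ∉ R → W m N (insert e B) (insert f R)) : W m N B R

def Good (m N : ℕ) (B R : Finset (Fin N × Fin N)) (e : Fin N × Fin N) : Prop :=
  e ∉ B ∧ e ∉ R ∧ ((HasM m N (insert e B) ∧ ¬ HasM m N R) ∨
    ((∃ f0, f0 ∉ insert e B ∧ f0 ∉ R) ∧
      ∀ f, f ∉ insert e B → f ∉ R → W m N (insert e B) (insert f R)))

theorem W.good {m N : ℕ} {B R : Finset (Fin N × Fin N)} (h : W m N B R) :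
    ∃ e, Good m N B R e := by
  cases h with
  | win e h1 h2 h3 h4 => exact ⟨e, h1, h2, Or.inl ⟨h3, h4⟩⟩
  | step e f0 h1 h2 h3 h4 h5 => exact ⟨e, h1, h2, Or.inr ⟨⟨f0, h3, h4⟩, h5⟩⟩

/-- The edge of the complete bipartite graph belonging to a pair. -/
def ed {N : ℕ} (p : Fin N × Fin N) : Sym2 (Fin N ⊕ Fin N) := s(Sum.inl p.1, Sum.inr p.2)

theorem ed_inj {N : ℕ} : Function.Injective (ed (N := N)) := by
  rintro ⟨a, b⟩ ⟨c, d⟩ h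
  simpa [ed] using h

abbrev KG (N : ℕ) := completeBipartiteGraph (Fin N) (Fin N)

theorem mem_edge {N : ℕ} (e : Sym2 (Fin N ⊕ Fin N)) :
    e ∈ (KG N).edgeSet ↔ ∃ p, e = ed p := by
  induction e using Sym2.ind with
  | _ x y =>
    rcases x with x | x <;> rcases y with y | y <;> simp [ed, completeBipartiteGraph]

theorem ed_mem {N : ℕ} (p : Fin N × Fin N) : ed p ∈ (KG N).edgeSet := (mem_edge _).2 ⟨p, rfl⟩

open Classical in
noncomputable def blue {N : ℕ} (l : List (Sym2 (Fin N ⊕ Fin N))) : Finset (Fin N × Fin N) :=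
  Finset.univ.filter (fun p => ∃ i, l[2 * i]? = some (ed p))

open Classical in
noncomputable def red {N : ℕ} (l : List (Sym2 (Fin N ⊕ Fin N))) : Finset (Fin N × Fin N) :=
  Finset.univ.filter (fun p => ∃ i, l[2 * i + 1]? = some (ed p))

theorem mem_list {N : ℕ} (l : List (Sym2 (Fin N ⊕ Fin N))) (p : Fin N × Fin N) :
    ed p ∈ l ↔ p ∈ blue l ∨ p ∈ red l := by
  simp only [blue, red, Finset.mem_filter, Finset.mem_univ, true_and, List.mem_iff_getElem?]
  constructor
  · rintro ⟨i, hi⟩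
    rcases Nat.even_or_odd' i with ⟨k, rfl | rfl⟩
    · exact Or.inl ⟨k, hi⟩
    · exact Or.inr ⟨k, hi⟩
  · rintro (⟨i, hi⟩ | ⟨i, hi⟩) <;> exact ⟨_, hi⟩

theorem hist_length {α : Type*} (σ τ : Strategy α) (n : ℕ) : (hist σ τ n).length = n := by
  induction n with
  | zero => rfl
  | succ n ih => simp [hist, ih]

theorem hist_succ {α : Type*} (σ τ : Strategy α) (n : ℕ) :
    hist σ τ (n + 1) = hist σ τ n ++ [move σ τ n] := rfl

theorem hist_get {α : Type*} (σ τ : Strategy α) (n i : ℕ) (e : Sym2 α) :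
    (hist σ τ n)[i]? = some e ↔ i < n ∧ move σ τ i = e := by
  induction n with
  | zero => simp [hist]
  | succ n ih =>
    rw [hist_succ, List.getElem?_append, hist_length]
    split_ifs with h
    · rw [ih]; constructor
      · rintro ⟨a, b⟩; exact ⟨by omega, b⟩
      · rintro ⟨a, b⟩; exact ⟨h, b⟩
    · by_cases h2 : i = n
      · subst h2; simp
      · rw [List.getElem?_eq_none (by simp; omega)]
        simp; omega

theorem mem_blue_hist {N : ℕ} (σ τ : Strategy (Fin N ⊕ Fin N)) (n : ℕ) (p) :
    p ∈ blue (hist σ τ n) ↔ ∃ i, 2 * i < n ∧ move σ τ (2 * i) = ed p := by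
  simp [blue, hist_get]

theorem mem_red_hist {N : ℕ} (σ τ : Strategy (Fin N ⊕ Fin N)) (n : ℕ) (p) :
    p ∈ red (hist σ τ n) ↔ ∃ i, 2 * i + 1 < n ∧ move σ τ (2 * i + 1) = ed p := by
  simp [red, hist_get]

theorem blue_even {N : ℕ} (σ τ : Strategy (Fin N ⊕ Fin N)) (j : ℕ) (p)
    (h : move σ τ (2 * j) = ed p) :
    blue (hist σ τ (2 * j + 1)) = insert p (blue (hist σ τ (2 * j))) := by
  ext q
  simp only [Finset.mem_insert, mem_blue_hist]
  constructor
  · rintro ⟨i, hi, hq⟩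
    by_cases hij : i = j
    · subst hij; rw [h] at hq; exact Or.inl (ed_inj hq).symm
    · exact Or.inr ⟨i, by omega, hq⟩
  · rintro (rfl | ⟨i, hi, hq⟩)
    · exact ⟨j, by omega, h⟩
    · exact ⟨i, by omega, hq⟩

theorem red_even {N : ℕ} (σ τ : Strategy (Fin N ⊕ Fin N)) (j : ℕ) :
    red (hist σ τ (2 * j + 1)) = red (hist σ τ (2 * j)) := by
  ext q
  simp only [mem_red_hist]
  constructor <;> rintro ⟨i, hi, hq⟩ <;> exact ⟨i, by omega, hq⟩

theorem red_odd {N : ℕ} (σ τ : Strategy (Fin N ⊕ Fin N)) (j : ℕ) (p)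
    (h : move σ τ (2 * j + 1) = ed p) :
    red (hist σ τ (2 * (j + 1))) = insert p (red (hist σ τ (2 * j))) := by
  ext q
  simp only [Finset.mem_insert, mem_red_hist]
  constructor
  · rintro ⟨i, hi, hq⟩
    by_cases hij : i = j
    · subst hij; rw [h] at hq; exact Or.inl (ed_inj hq).symm
    · exact Or.inr ⟨i, by omega, hq⟩
  · rintro (rfl | ⟨i, hi, hq⟩)
    · exact ⟨j, by omega, h⟩
    · exact ⟨i, by omega, hq⟩

theorem blue_odd {N : ℕ} (σ τ : Strategy (Fin N ⊕ Fin N)) (j : ℕ) :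
    blue (hist σ τ (2 * (j + 1))) = blue (hist σ τ (2 * j + 1)) := by
  ext q
  simp only [mem_blue_hist]
  constructor <;> rintro ⟨i, hi, hq⟩ <;> exact ⟨i, by omega, hq⟩

/-- Legality of a history. -/
def Legal {N : ℕ} (l : List (Sym2 (Fin N ⊕ Fin N))) : Prop :=
  l.Nodup ∧ ∀ e ∈ l, e ∈ (KG N).edgeSet

theorem legal_length {N : ℕ} {l : List (Sym2 (Fin N ⊕ Fin N))} (h : Legal l) :
    l.length ≤ (KG N).edgeSet.ncard := by
  classical
  have : (l.toFinset : Set _) ⊆ (KG N).edgeSet := by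
    intro e he; exact h.2 e (by simpa using he)
  have h2 := Set.ncard_le_ncard this (Set.toFinite _)
  rwa [Set.ncard_coe_finset, List.toFinset_card_of_nodup h.1] at h2

theorem exists_free {N : ℕ} {l : List (Sym2 (Fin N ⊕ Fin N))}
    (h : l.length < (KG N).edgeSet.ncard) : ∃ e ∈ (KG N).edgeSet, e ∉ l := by
  classical
  by_contra! hc
  have : (KG N).edgeSet ⊆ (l.toFinset : Set _) := by
    intro e he; simpa using hc e he
  have h2 := Set.ncard_le_ncard this (Set.toFinite _)
  rw [Set.ncard_coe_finset] at h2
  have := l.toFinset_card_le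
  omega

theorem move_legal {N : ℕ} {σ τ : Strategy (Fin N ⊕ Fin N)} (hσ : Strategy.Valid (KG N) σ)
    (hτ : Strategy.Valid (KG N) τ) (n : ℕ) (h : ∃ e ∈ (KG N).edgeSet, e ∉ hist σ τ n) :
    move σ τ n ∈ (KG N).edgeSet ∧ move σ τ n ∉ hist σ τ n := by
  unfold move
  split_ifs
  · exact hσ _ h
  · exact hτ _ h

theorem hist_legal {N : ℕ} {σ τ : Strategy (Fin N ⊕ Fin N)} (hσ : Strategy.Valid (KG N) σ)
    (hτ : Strategy.Valid (KG N) τ) (n : ℕ) (hn : n ≤ (KG N).edgeSet.ncard) :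
    Legal (hist σ τ n) := by
  induction n with
  | zero => exact ⟨by simp [hist], by simp [hist]⟩
  | succ n ih =>
    have ih := ih (by omega)
    have := move_legal hσ hτ n (exists_free (by rw [hist_length]; omega))
    rw [hist_succ]
    refine ⟨?_, ?_⟩
    · rw [List.nodup_append]
      refine ⟨ih.1, by simp, ?_⟩
      intro a ha b hb
      simp at hb
      rintro rfl
      exact this.2 (hb ▸ ha)
    · intro e he
      rw [List.mem_append] at he
      rcases he with he | he
      · exact ih.2 e he
      · simp at he; rw [he]; exact this.1

theorem blue_set {N : ℕ} {σ τ : Strategy (Fin N ⊕ Fin N)} (hσ : Strategy.Valid (KG N) σ)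
    (hτ : Strategy.Valid (KG N) τ) (k : ℕ) (hk : 2 * k + 1 ≤ (KG N).edgeSet.ncard) :
    {e | ∃ i ≤ k, e = move σ τ (2 * i)} = ed '' (blue (hist σ τ (2 * k + 1)) : Set _) := by
  ext e
  simp only [Set.mem_ofPred_eq, Set.mem_image, Finset.mem_coe, mem_blue_hist]
  constructor
  · rintro ⟨i, hi, rfl⟩
    obtain ⟨p, hp⟩ := (mem_edge _).1 (move_legal hσ hτ (2 * i)
      (exists_free (by rw [hist_length]; omega))).1
    exact ⟨p, ⟨i, by omega, hp⟩, hp.symm⟩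
  · rintro ⟨p, ⟨i, hi, hp⟩, rfl⟩
    exact ⟨i, by omega, hp.symm⟩

theorem red_set {N : ℕ} {σ τ : Strategy (Fin N ⊕ Fin N)} (hσ : Strategy.Valid (KG N) σ)
    (hτ : Strategy.Valid (KG N) τ) (k : ℕ) (hk : 2 * k + 1 ≤ (KG N).edgeSet.ncard) :
    {e | ∃ i < k, e = move σ τ (2 * i + 1)} = ed '' (red (hist σ τ (2 * k)) : Set _) := by
  ext e
  simp only [Set.mem_ofPred_eq, Set.mem_image, Finset.mem_coe, mem_red_hist]
  constructor
  · rintro ⟨i, hi, rfl⟩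
    obtain ⟨p, hp⟩ := (mem_edge _).1 (move_legal hσ hτ (2 * i + 1)
      (exists_free (by rw [hist_length]; omega))).1
    exact ⟨p, ⟨i, by omega, hp⟩, hp.symm⟩
  · rintro ⟨p, ⟨i, hi, hp⟩, rfl⟩
    exact ⟨i, by omega, hp.symm⟩

theorem hasCopy_iff {N n : ℕ} (B : Finset (Fin N × Fin N)) :
    HasCopy (starMatching 1 n) (ed '' (B : Set (Fin N × Fin N))) ↔ HasM (n + 1) N B := by
  constructor
  · rintro ⟨φ, hφ⟩
    have key : ∀ a b, (starMatching 1 n).Adj a b → ∃ p ∈ B,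
        (φ a = Sum.inl p.1 ∧ φ b = Sum.inr p.2) ∨ (φ b = Sum.inl p.1 ∧ φ a = Sum.inr p.2) := by
      intro a b hab
      obtain ⟨p, hp, hpe⟩ := hφ a b hab
      refine ⟨p, hp, ?_⟩
      simp only [ed, Sym2.eq_iff] at hpe
      rcases hpe with ⟨h1, h2⟩ | ⟨h1, h2⟩
      · exact Or.inl ⟨h1.symm, h2.symm⟩
      · exact Or.inr ⟨h1.symm, h2.symm⟩
    let u : Fin (n + 1) → Fin 2 ⊕ (Fin n ⊕ Fin n) :=
      Fin.cases (Sum.inl 0) (fun i => Sum.inr (Sum.inl i))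
    let v : Fin (n + 1) → Fin 2 ⊕ (Fin n ⊕ Fin n) :=
      Fin.cases (Sum.inl 1) (fun i => Sum.inr (Sum.inr i))
    have hadj : ∀ i, (starMatching 1 n).Adj (u i) (v i) := by
      intro i
      refine Fin.cases ?_ (fun i => ?_) i <;> simp [u, v, starMatching]
    have hu : Function.Injective u := by
      intro i j
      refine Fin.cases ?_ (fun i => ?_) i <;> refine Fin.cases ?_ (fun j => ?_) j <;> simp [u]
    have hv : Function.Injective v := by
      intro i j
      refine Fin.cases ?_ (fun i => ?_) i <;> refine Fin.cases ?_ (fun j => ?_) j <;> simp [v]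
    have huv : ∀ i j, u i ≠ v j := by
      intro i j
      refine Fin.cases ?_ (fun i => ?_) i <;> refine Fin.cases ?_ (fun j => ?_) j <;> simp [u, v]
    choose p hp hpp using fun i => key _ _ (hadj i)
    refine ⟨fun i => (p i).1, fun i => (p i).2, ?_, ?_, fun i => hp i⟩
    · intro i j hij
      simp only at hij
      rcases hpp i with h | h <;> rcases hpp j with h' | h' <;> rw [hij, ← h'.1] at h
      · exact hu (φ.injective h.1)
      · exact absurd (φ.injective h.1) (huv _ _)
      · exact absurd (φ.injective h.1) (huv _ _).symm
      · exact hv (φ.injective h.1)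
    · intro i j hij
      simp only at hij
      rcases hpp i with h | h <;> rcases hpp j with h' | h' <;> rw [hij, ← h'.2] at h
      · exact hv (φ.injective h.2)
      · exact absurd (φ.injective h.2) (huv _ _).symm
      · exact absurd (φ.injective h.2) (huv _ _)
      · exact hu (φ.injective h.2)
  · rintro ⟨f, g, hf, hg, hB⟩
    let φ : Fin 2 ⊕ (Fin n ⊕ Fin n) → Fin N ⊕ Fin N := fun x => match x with
      | Sum.inl i => if i = 0 then Sum.inl (f 0) else Sum.inr (g 0)
      | Sum.inr (Sum.inl i) => Sum.inl (f i.succ)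
      | Sum.inr (Sum.inr i) => Sum.inr (g i.succ)
    have hφ : Function.Injective φ := by
      have hf0 : ∀ i : Fin n, f i.succ ≠ f 0 := fun i h => Fin.succ_ne_zero _ (hf h)
      have hg0 : ∀ i : Fin n, g i.succ ≠ g 0 := fun i h => Fin.succ_ne_zero _ (hg h)
      rintro (i | i | i) (j | j | j)
      · fin_cases i <;> fin_cases j <;> simp [φ]
      · fin_cases i <;> simp [φ, (hf0 j).symm]
      · fin_cases i <;> simp [φ, (hg0 j).symm]
      · fin_cases j <;> simp [φ, (hf0 i)]
      · intro h; simp [φ] at h; simpa using hf h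
      · simp [φ]
      · fin_cases j <;> simp [φ, (hg0 i)]
      · simp [φ]
      · intro h; simp [φ] at h; simpa using hg h
    refine ⟨⟨φ, hφ⟩, ?_⟩
    have base : ∀ a b, ((a = Sum.inl 0 ∧ ∃ i : Fin 2, b = Sum.inl i) ∨
        (∃ i : Fin n, a = Sum.inr (Sum.inl i) ∧ b = Sum.inr (Sum.inr i))) → a ≠ b →
        s(φ a, φ b) ∈ ed '' (B : Set (Fin N × Fin N)) := by
      rintro a b (⟨rfl, i, rfl⟩ | ⟨i, rfl, rfl⟩) hne
      · fin_cases i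
        · simp at hne
        · exact ⟨_, hB 0, by simp [ed, φ]⟩
      · exact ⟨_, hB i.succ, by simp [ed, φ]⟩
    intro a b hab
    rw [starMatching, SimpleGraph.fromRel_adj] at hab
    rcases hab with ⟨hne, h | h⟩
    · exact base a b h hne
    · have := base b a h hne.symm
      rw [Sym2.eq_swap] at this
      exact this

theorem aliceWins_of_W {N n : ℕ} (hN : 0 < N) (hW : W (n + 1) N ∅ ∅) :
    AliceWins (starMatching 1 n) (KG N) := by
  classical
  let d : Sym2 (Fin N ⊕ Fin N) := ed (⟨0, hN⟩, ⟨0, hN⟩)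
  let σ : Strategy (Fin N ⊕ Fin N) := fun l =>
    if h : ∃ p, Good (n + 1) N (blue l) (red l) p then ed h.choose
    else if h : ∃ e ∈ (KG N).edgeSet, e ∉ l then h.choose else d
  have hσ : Strategy.Valid (KG N) σ := by
    intro l hl
    by_cases h : ∃ p, Good (n + 1) N (blue l) (red l) p
    · have : σ l = ed h.choose := by simp only [σ]; rw [dif_pos h]
      rw [this]
      refine ⟨ed_mem _, ?_⟩
      rw [mem_list]
      have := h.choose_spec
      rintro (h' | h')
      · exact this.1 h'
      · exact this.2.1 h'
    · have : σ l = hl.choose := by simp only [σ]; rw [dif_neg h, dif_pos hl]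
      rw [this]; exact hl.choose_spec
  refine ⟨σ, hσ, fun τ hτ => ?_⟩
  have main : ∀ d j, (KG N).edgeSet.ncard ≤ d + 2 * j → 2 * j ≤ (KG N).edgeSet.ncard →
      W (n + 1) N (blue (hist σ τ (2 * j))) (red (hist σ τ (2 * j))) →
      ∃ k : ℕ, 2 * k + 1 ≤ (KG N).edgeSet.ncard ∧
        HasCopy (starMatching 1 n) {e | ∃ i ≤ k, e = move σ τ (2 * i)} ∧
        ¬ HasCopy (starMatching 1 n) {e | ∃ i < k, e = move σ τ (2 * i + 1)} := by
    intro d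
    induction d using Nat.strong_induction_on with
    | _ d ih =>
    intro j hd hj hw
    have h := hw.good
    have hmove : move σ τ (2 * j) = ed h.choose := by
      have : move σ τ (2 * j) = σ (hist σ τ (2 * j)) := by simp [move]
      rw [this]; simp only [σ]; rw [dif_pos h]
    obtain ⟨hg1, hg2, hg3⟩ := h.choose_spec
    set p := h.choose with hp
    have hleg := hist_legal hσ hτ (2 * j) hj
    have hpf : ed p ∉ hist σ τ (2 * j) := by
      rw [mem_list]; rintro (h' | h')
      · exact hg1 h'
      · exact hg2 h'
    have hlt : 2 * j + 1 ≤ (KG N).edgeSet.ncard := by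
      by_contra hc
      have : Legal (ed p :: hist σ τ (2 * j)) := by
        refine ⟨List.nodup_cons.2 ⟨hpf, hleg.1⟩, ?_⟩
        intro e he
        rcases List.mem_cons.1 he with rfl | he
        · exact ed_mem _
        · exact hleg.2 e he
      have := legal_length this
      rw [List.length_cons, hist_length] at this
      omega
    have hb := blue_even σ τ j p hmove
    rcases hg3 with ⟨hg3, hg4⟩ | ⟨⟨f0, hf1, hf2⟩, hg4⟩
    · refine ⟨j, hlt, ?_, ?_⟩
      · rw [blue_set hσ hτ j hlt, hasCopy_iff, hb]; exact hg3
      · rw [red_set hσ hτ j hlt, hasCopy_iff]; exact hg4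
    · have hf : ed f0 ∉ hist σ τ (2 * j + 1) := by
        rw [mem_list, hb, red_even]; rintro (h' | h')
        · exact hf1 h'
        · exact hf2 h'
      have hm := move_legal hσ hτ (2 * j + 1) ⟨_, ed_mem f0, hf⟩
      obtain ⟨f, hfe⟩ := (mem_edge _).1 hm.1
      have hm2 := hm.2
      rw [hfe, mem_list, hb, red_even, not_or] at hm2
      have hleg1 := hist_legal hσ hτ (2 * j + 1) hlt
      have hlt2 : 2 * (j + 1) ≤ (KG N).edgeSet.ncard := by
        have : Legal (ed f0 :: hist σ τ (2 * j + 1)) := by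
          refine ⟨List.nodup_cons.2 ⟨hf, hleg1.1⟩, ?_⟩
          intro e he
          rcases List.mem_cons.1 he with rfl | he
          · exact ed_mem _
          · exact hleg1.2 e he
        have := legal_length this
        rw [List.length_cons, hist_length] at this
        omega
      refine ih (d - 2) (by omega) (j + 1) (by omega) hlt2 ?_
      rw [red_odd σ τ j f hfe, blue_odd, hb]
      exact hg4 f hm2.1 hm2.2
  refine main _ 0 (le_refl _) (by omega) ?_
  have h1 : blue (hist σ τ (2 * 0)) = ∅ := by ext q; simp [mem_blue_hist]
  have h2 : red (hist σ τ (2 * 0)) = ∅ := by ext q; simp [mem_red_hist]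
  rw [h1, h2]; exact hW

/-- Positions (Alice to move) in which Bob can prevent Alice from winning for `k` rounds. -/
def D (m N : ℕ) : ℕ → Finset (Fin N × Fin N) → Finset (Fin N × Fin N) → Prop
  | 0, _, _ => True
  | k + 1, B, R => ∀ e, e ∉ B → e ∉ R → ¬ HasM m N (insert e B) ∧
      (k = 0 ∨ ∃ f, f ∉ insert e B ∧ f ∉ R ∧ D m N k (insert e B) (insert f R))

theorem not_aliceWins_of_D {N n K : ℕ} (hK : N * N ≤ 2 * K)
    (hD : D (n + 1) N K ∅ ∅) : ¬ AliceWins (starMatching 1 n) (KG N) := by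
  classical
  rintro ⟨σ, hσ, hall⟩
  let τ : Strategy (Fin N ⊕ Fin N) := fun l =>
    if h : ∃ p, p ∉ blue l ∧ p ∉ red l ∧
      D (n + 1) N (K - (l.length + 1) / 2) (blue l) (insert p (red l)) then ed h.choose
    else if h : ∃ e ∈ (KG N).edgeSet, e ∉ l then h.choose else σ []
  have hτ : Strategy.Valid (KG N) τ := by
    intro l hl
    by_cases h : ∃ p, p ∉ blue l ∧ p ∉ red l ∧
      D (n + 1) N (K - (l.length + 1) / 2) (blue l) (insert p (red l))
    · have : τ l = ed h.choose := by simp only [τ]; rw [dif_pos h]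
      rw [this]
      refine ⟨ed_mem _, ?_⟩
      rw [mem_list]
      have := h.choose_spec
      rintro (h' | h')
      · exact this.1 h'
      · exact this.2.1 h'
    · have : τ l = hl.choose := by simp only [τ]; rw [dif_neg h, dif_pos hl]
      rw [this]; exact hl.choose_spec
  have hcard : (KG N).edgeSet.ncard = N * N := by
    have : (KG N).edgeSet = Set.range (ed (N := N)) := by
      ext e; rw [mem_edge]; simp [eq_comm]
    rw [this, ← Set.image_univ, Set.ncard_image_of_injective _ ed_inj, Set.ncard_univ]
    simp
  have alice : ∀ j, 2 * j + 1 ≤ N * N → ∃ p, move σ τ (2 * j) = ed p ∧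
      p ∉ blue (hist σ τ (2 * j)) ∧ p ∉ red (hist σ τ (2 * j)) := by
    intro j hj
    have hm := move_legal hσ hτ (2 * j) (exists_free (by rw [hist_length]; omega))
    obtain ⟨p, hp⟩ := (mem_edge _).1 hm.1
    have hm2 := hm.2
    rw [hp, mem_list, not_or] at hm2
    exact ⟨p, hp, hm2⟩
  have main : ∀ j, 2 * j + 1 ≤ N * N →
      D (n + 1) N (K - j) (blue (hist σ τ (2 * j))) (red (hist σ τ (2 * j))) := by
    intro j
    induction j with
    | zero =>
      intro _
      have h1 : blue (hist σ τ (2 * 0)) = ∅ := by ext q; simp [mem_blue_hist]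
      have h2 : red (hist σ τ (2 * 0)) = ∅ := by ext q; simp [mem_red_hist]
      rw [h1, h2]; exact hD
    | succ j ih =>
      intro hj
      have ih := ih (by omega)
      obtain ⟨p, hp, hp1, hp2⟩ := alice j (by omega)
      obtain ⟨k, hk⟩ : ∃ k, K - j = k + 1 := ⟨K - j - 1, by omega⟩
      rw [hk] at ih
      have h := (ih p hp1 hp2).2
      have hk' : K - (j + 1) = k := by omega
      have hb := blue_even σ τ j p hp
      have hex : ∃ f, f ∉ blue (hist σ τ (2 * j + 1)) ∧ f ∉ red (hist σ τ (2 * j + 1)) ∧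
          D (n + 1) N (K - ((hist σ τ (2 * j + 1)).length + 1) / 2)
            (blue (hist σ τ (2 * j + 1))) (insert f (red (hist σ τ (2 * j + 1)))) := by
        rw [hist_length, hb, red_even]
        have : K - (2 * j + 1 + 1) / 2 = k := by omega
        rw [this]
        rcases h with h | h
        · omega
        · exact h
      have hmove : move σ τ (2 * j + 1) = ed hex.choose := by
        have : move σ τ (2 * j + 1) = τ (hist σ τ (2 * j + 1)) := by
          simp [move, Nat.add_mod]
        rw [this]; simp only [τ]; rw [dif_pos hex]
      have hs := hex.choose_spec.2.2
      generalize hex.choose = f at hmove hs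
      rw [hist_length] at hs
      have : K - (2 * j + 1 + 1) / 2 = K - (j + 1) := by omega
      rw [this] at hs
      rw [red_odd σ τ j _ hmove, blue_odd, ← red_even]
      exact hs
  obtain ⟨k, hk, hc, -⟩ := hall τ hτ
  rw [blue_set hσ hτ k hk, hasCopy_iff] at hc
  rw [hcard] at hk
  obtain ⟨p, hp, hp1, hp2⟩ := alice k hk
  have h := main k hk
  obtain ⟨k', hk'⟩ : ∃ k', K - k = k' + 1 := ⟨K - k - 1, by omega⟩
  rw [hk'] at h
  rw [blue_even σ τ k p hp] at hc
  exact (h p hp1 hp2).1 hc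

theorem hasCopy_le {N n : ℕ} (h : AliceWins (starMatching 1 n) (KG N)) : n + 1 ≤ N := by
  obtain ⟨σ, -, h⟩ := h
  classical
  by_cases hv : ∃ τ, Strategy.Valid (KG N) τ
  · obtain ⟨τ, hτ⟩ := hv
    obtain ⟨k, -, ⟨f, -⟩, -⟩ := h τ hτ
    have := Fintype.card_le_of_injective f f.injective
    simp at this
    omega
  · exfalso
    apply hv
    refine ⟨fun l => if h : ∃ e ∈ (KG N).edgeSet, e ∉ l then h.choose else σ [], ?_⟩
    intro l hl
    simp only [dif_pos hl]
    exact hl.choose_spec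

end AGProof

namespace AGProof

/-- Computation of drawn positions with bit masks. -/
def dr (M : List ℕ) (pm : ℕ → Bool) : ℕ → ℕ → ℕ → Bool
  | 0, _, _ => true
  | k + 1, b, r => M.all fun e => (b ||| r).testBit e ||
      (!pm (b ||| 2 ^ e) && (k == 0 || M.any fun f =>
        (!(b ||| 2 ^ e ||| r).testBit f && dr M pm k (b ||| 2 ^ e) (r ||| 2 ^ f))))

def idx {N : ℕ} (e : Fin N × Fin N) : ℕ := N * e.1 + e.2

def Rep {N : ℕ} (b : ℕ) (B : Finset (Fin N × Fin N)) : Prop :=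
  ∀ e, e ∈ B ↔ b.testBit (idx e) = true

theorem idx_inj {N : ℕ} : Function.Injective (idx (N := N)) := by
  rintro ⟨a, b⟩ ⟨c, d⟩ h
  simp only [idx] at h
  have hN : 0 < N := a.pos
  have h1 := congrArg (· / N) h
  have h2 := congrArg (· % N) h
  simp [Nat.mul_add_div hN, Nat.div_eq_of_lt, Nat.mul_add_mod, Nat.mod_eq_of_lt] at h1 h2
  ext <;> simp [h1, h2]

theorem rep_insert {N : ℕ} {b : ℕ} {B : Finset (Fin N × Fin N)} (h : Rep b B) (e) :
    Rep (b ||| 2 ^ (idx e)) (insert e B) := by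
  intro x
  rw [Finset.mem_insert, h x, Nat.testBit_or, Nat.testBit_two_pow]
  simp only [Bool.or_eq_true, decide_eq_true_eq]
  constructor
  · rintro (rfl | h)
    · right; rfl
    · left; exact h
  · rintro (h | h)
    · right; exact h
    · left; exact (idx_inj h).symm

theorem dr_sound {m N : ℕ} (pm : ℕ → Bool)
    (hpm : ∀ b (B : Finset (Fin N × Fin N)), Rep b B → HasM m N B → pm b = true) :
    ∀ k b r (B R : Finset (Fin N × Fin N)), Rep b B → Rep r R →
      dr (List.range (N * N)) pm k b r = true → D m N k B R := by
  intro k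
  induction k with
  | zero => intros; trivial
  | succ k ih =>
    intro b r B R hB hR h e he1 he2
    rw [dr, List.all_eq_true] at h
    have hlt : idx e < N * N := by
      have h1 := e.1.isLt
      have h2 := e.2.isLt
      simp only [idx]
      nlinarith
    have h := h (idx e) (List.mem_range.2 hlt)
    have h1 : b.testBit (idx e) = false := by
      have := (hB e).not.1 he1; simpa using this
    have h2 : r.testBit (idx e) = false := by
      have := (hR e).not.1 he2; simpa using this
    rw [Nat.testBit_or, h1, h2] at h
    simp only [Bool.or_self, Bool.false_or, Bool.and_eq_true, Bool.or_eq_true,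
      beq_iff_eq, List.any_eq_true, Bool.not_eq_true', List.mem_range] at h
    have hB' := rep_insert hB e
    refine ⟨fun hm => ?_, ?_⟩
    · rw [hpm _ _ hB' hm] at h; simp at h
    · rcases h.2 with h | ⟨f, hf, hf1, hf2⟩
      · exact Or.inl h
      · right
        have hN : 0 < N := e.1.pos
        obtain ⟨p, rfl⟩ : ∃ p : Fin N × Fin N, idx p = f :=
          ⟨(⟨f / N, Nat.div_lt_of_lt_mul hf⟩, ⟨f % N, Nat.mod_lt _ hN⟩), by
            simp [idx, Nat.div_add_mod]⟩
        rw [Nat.testBit_or] at hf1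
        simp only [Bool.or_eq_false_iff] at hf1
        refine ⟨p, ?_, ?_, ih _ _ _ _ hB' (rep_insert hR p) hf2⟩
        · rw [hB' p, hf1.1]; simp
        · rw [hR p, hf1.2]; simp

def pm2 (b : ℕ) : Bool := (b.testBit 0 && b.testBit 3) || (b.testBit 1 && b.testBit 2)

def pm3 (b : ℕ) : Bool :=
  (b.testBit 0 && ((b.testBit 4 && b.testBit 8) || (b.testBit 5 && b.testBit 7))) ||
  (b.testBit 1 && ((b.testBit 3 && b.testBit 8) || (b.testBit 5 && b.testBit 6))) ||
  (b.testBit 2 && ((b.testBit 3 && b.testBit 7) || (b.testBit 4 && b.testBit 6)))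

theorem rep_empty {N : ℕ} : Rep 0 (∅ : Finset (Fin N × Fin N)) := by
  intro e; simp

theorem hasM_perm {N : ℕ} {B : Finset (Fin N × Fin N)} (h : HasM N N B) :
    ∃ c : Fin N → Fin N, Function.Injective c ∧ ∀ i, (i, c i) ∈ B := by
  obtain ⟨f, g, hf, hg, h⟩ := h
  have hs := Finite.surjective_of_injective hf
  choose t ht using hs
  refine ⟨fun i => g (t i), ?_, ?_⟩
  · intro i j hij
    have := hg hij
    rw [← ht i, ← ht j, this]
  · intro i
    have := h (t i)
    rwa [ht] at this

theorem D2 : D 2 2 2 ∅ ∅ := by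
  refine dr_sound pm2 ?_ 2 0 0 _ _ rep_empty rep_empty (by decide +kernel)
  intro b B hB h
  obtain ⟨c, hc, h⟩ := hasM_perm h
  have h0 := (hB _).1 (h 0)
  have h1 := (hB _).1 (h 1)
  have h01 : c 0 ≠ c 1 := fun h => by simpa using hc h
  simp only [idx] at h0 h1
  generalize c 0 = x at *
  generalize c 1 = y at *
  fin_cases x <;> fin_cases y <;> simp_all [pm2]

theorem D3 : D 3 3 5 ∅ ∅ := by
  refine dr_sound pm3 ?_ 5 0 0 _ _ rep_empty rep_empty (by decide +kernel)
  intro b B hB h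
  obtain ⟨c, hc, h⟩ := hasM_perm h
  have h0 := (hB _).1 (h 0)
  have h1 := (hB _).1 (h 1)
  have h2 := (hB _).1 (h 2)
  have h01 : c 0 ≠ c 1 := fun h => by simpa using hc h
  have h02 : c 0 ≠ c 2 := fun h => by simpa using hc h
  have h12 : c 1 ≠ c 2 := fun h => by simpa using hc h
  simp only [idx] at h0 h1 h2
  generalize c 0 = x at *
  generalize c 1 = y at *
  generalize c 2 = z at *
  fin_cases x <;> fin_cases y <;> fin_cases z <;> simp_all [pm3]

theorem hasM_card {m N : ℕ} {R : Finset (Fin N × Fin N)} (h : HasM m N R) : m ≤ R.card := by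
  obtain ⟨f, g, hf, hg, h⟩ := h
  have := Finset.card_le_card_of_injOn (s := Finset.univ) (t := R) (fun i => (f i, g i))
    (fun i _ => h i) (fun i _ j _ hij => hf (Prod.ext_iff.1 hij).1)
  simpa using this

theorem W23 : W 2 3 ∅ ∅ := by
  refine W.step (0, 0) (1, 1) (by simp) (by simp) (by simp) (by simp) ?_
  intro f hf _
  have hR : ¬ HasM 2 3 (insert f ∅) := fun h => by
    have := hasM_card h; simp at this
  by_cases h : f = (1, 1)
  · subst h
    refine W.win (1, 2) (by decide) (by decide) ?_ hR
    exact ⟨![0, 1], ![0, 2], by decide, by decide, by decide⟩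
  · refine W.win (1, 1) (by decide) (by simpa using fun h' => h h'.symm) ?_ hR
    exact ⟨![0, 1], ![0, 1], by decide, by decide, by decide⟩

theorem W34aux (R : Finset (Fin 4 × Fin 4)) (hR : R.card ≤ 2) (x y z : Fin 4)
    (hx : ((0 : Fin 4) ≠ x) ∧ 0 ≠ y ∧ 0 ≠ z ∧ x ≠ y ∧ x ≠ z ∧ y ≠ z) :
    W 3 4 (insert (1, x) (insert (0, 0) ∅)) R := by
  have hR' : ¬ HasM 3 4 R := fun h => by have := hasM_card h; omega
  have : ∃ p : Fin 4 × Fin 4, p ∉ R ∧ (p = (2, y) ∨ p = (2, z) ∨ p = (3, y)) := by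
    by_contra! hc
    have h1 : (2, y) ∈ R := by by_contra h; exact (hc _ h).1 rfl
    have h2 : (2, z) ∈ R := by by_contra h; exact (hc _ h).2.1 rfl
    have h3 : (3, y) ∈ R := by by_contra h; exact (hc _ h).2.2 rfl
    have hsub : ({(2, y), (2, z), (3, y)} : Finset (Fin 4 × Fin 4)) ⊆ R := by
      intro q hq
      simp at hq
      rcases hq with rfl | rfl | rfl <;> assumption
    have hle := Finset.card_le_card hsub
    have h3 : ({(2, y), (2, z), (3, y)} : Finset (Fin 4 × Fin 4)).card = 3 := by
      rw [Finset.card_eq_three]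
      exact ⟨_, _, _, by simp [hx], by simp, by simp, rfl⟩
    omega
  obtain ⟨p, hp, hpp⟩ := this
  obtain ⟨h1, h2, h3, h4, h5, h6⟩ := hx
  refine W.win p ?_ hp ?_ hR'
  · rcases hpp with rfl | rfl | rfl <;> simp
  · refine ⟨![0, 1, p.1], ![0, x, p.2], ?_, ?_, ?_⟩
    · intro i j
      rcases hpp with rfl | rfl | rfl <;> fin_cases i <;> fin_cases j <;> simp
    · intro i j
      rcases hpp with rfl | rfl | rfl <;> fin_cases i <;> fin_cases j <;>
        simp [h1, h2, h3, h4, h5, h1.symm, h2.symm, h3.symm, h4.symm, h5.symm]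
    · intro i
      fin_cases i <;> simp

theorem W34 : W 3 4 ∅ ∅ := by
  refine W.step (0, 0) (1, 1) (by simp) (by simp) (by simp) (by simp) ?_
  intro f hf _
  by_cases h : f = (1, 1)
  · subst h
    refine W.step (1, 2) (3, 3) (by decide) (by decide) (by decide) (by decide) ?_
    intro f hf _
    exact W34aux _ (Finset.card_le_two) 2 1 3 (by decide)
  · by_cases h2 : f = (3, 3)
    · subst h2
      refine W.step (1, 1) (3, 2) (by decide) (by decide) (by decide) (by decide) ?_
      intro f hf _
      exact W34aux _ (Finset.card_le_two) 1 2 3 (by decide)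
    · refine W.step (1, 1) (3, 3) (by decide) (by simpa using fun h' => h h'.symm) (by decide)
        (by simpa using fun h' => h2 h'.symm) ?_
      intro f hf _
      exact W34aux _ (Finset.card_le_two) 1 2 3 (by decide)

end AGProof
namespace AGProof

/-- The blue edges form a partial matching contained in a permutation `π`, leaving
rows `Ar` and columns `Bc` uncovered. -/
def Inv {m : ℕ} (B : Finset (Fin m × Fin m)) (Ar Bc : Finset (Fin m)) : Prop :=
  ∃ π : Equiv.Perm (Fin m), (∀ a, a ∈ Ar ↔ π a ∈ Bc) ∧
    ∀ p : Fin m × Fin m, p ∈ B ↔ p.1 ∉ Ar ∧ p.2 = π p.1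

lemma Inv.play {m : ℕ} {B : Finset (Fin m × Fin m)} {Ar Bc : Finset (Fin m)}
    (h : Inv B Ar Bc) {a b : Fin m} (ha : a ∈ Ar) (hb : b ∈ Bc) :
    Inv (insert (a, b) B) (Ar.erase a) (Bc.erase b) := by
  obtain ⟨π, h1, h2⟩ := h
  have key : ∀ x, ((Equiv.swap a (π.symm b)).trans π) x =
      if x = a then b else if x = π.symm b then π a else π x := by
    intro x
    simp only [Equiv.trans_apply, Equiv.swap_apply_def]
    split_ifs <;> simp
  have hb' : π.symm b ∈ Ar := by rw [h1]; simpa using hb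
  refine ⟨(Equiv.swap a (π.symm b)).trans π, ?_, ?_⟩
  · intro x
    rw [key]
    have e1 : x = π.symm b ↔ π x = b := by rw [Equiv.eq_symm_apply]
    have e2 : π a = b ↔ a = π.symm b := by rw [Equiv.eq_symm_apply]
    have h1a := (h1 a).1 ha
    have h1x := h1 x
    simp only [Finset.mem_erase]
    split_ifs <;> grind
  · rintro ⟨x, y⟩
    rw [Finset.mem_insert, h2, Prod.mk.injEq]
    simp only [key]
    simp only [Finset.mem_erase]
    split_ifs <;> grind

lemma Inv.swap {m : ℕ} {B : Finset (Fin m × Fin m)} {Ar Bc : Finset (Fin m)}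
    (h : Inv B Ar Bc) : Inv (B.map (Equiv.prodComm _ _).toEmbedding) Bc Ar := by
  obtain ⟨π, h1, h2⟩ := h
  refine ⟨π.symm, ?_, ?_⟩
  · intro x; rw [h1]; simp
  · rintro ⟨x, y⟩
    have : (x, y) ∈ B.map (Equiv.prodComm _ _).toEmbedding ↔ (y, x) ∈ B := by
      simp [Finset.mem_map_equiv]
    rw [this, h2]
    simp only [h1]
    rw [Equiv.eq_symm_apply]
    constructor
    · rintro ⟨h, rfl⟩; exact ⟨h, rfl⟩
    · rintro ⟨h, rfl⟩; exact ⟨h, rfl⟩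

abbrev sw {N : ℕ} (B : Finset (Fin N × Fin N)) : Finset (Fin N × Fin N) :=
  B.map (Equiv.prodComm _ _).toEmbedding

lemma mem_sw {N : ℕ} {B : Finset (Fin N × Fin N)} {p : Fin N × Fin N} :
    p ∈ sw B ↔ p.swap ∈ B := by
  simp [sw, Finset.mem_map_equiv]

lemma sw_sw {N : ℕ} (B : Finset (Fin N × Fin N)) : sw (sw B) = B := by
  ext p; rw [mem_sw, mem_sw, Prod.swap_swap]

lemma sw_insert {N : ℕ} (B : Finset (Fin N × Fin N)) (e : Fin N × Fin N) :
    sw (insert e B) = insert e.swap (sw B) := by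
  ext p
  simp only [mem_sw, Finset.mem_insert]
  rw [Prod.swap_eq_iff_eq_swap]

lemma hasM_sw {m N : ℕ} {B : Finset (Fin N × Fin N)} (h : HasM m N B) : HasM m N (sw B) := by
  obtain ⟨f, g, hf, hg, hfg⟩ := h
  exact ⟨g, f, hg, hf, fun i => by rw [mem_sw]; exact hfg i⟩

lemma W_sw {m N : ℕ} {B R : Finset (Fin N × Fin N)} (h : W m N B R) :
    W m N (sw B) (sw R) := by
  induction h with
  | win e h1 h2 h3 h4 =>
    refine W.win e.swap ?_ ?_ ?_ ?_
    · rw [mem_sw, Prod.swap_swap]; exact h1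
    · rw [mem_sw, Prod.swap_swap]; exact h2
    · rw [← sw_insert]; exact hasM_sw h3
    · intro h; apply h4; have := hasM_sw h; rwa [sw_sw] at this
  | step e f0 h1 h2 h3 h4 h5 ih =>
    refine W.step e.swap f0.swap ?_ ?_ ?_ ?_ ?_
    · rw [mem_sw, Prod.swap_swap]; exact h1
    · rw [mem_sw, Prod.swap_swap]; exact h2
    · rw [← sw_insert, mem_sw, Prod.swap_swap]; exact h3
    · rw [mem_sw, Prod.swap_swap]; exact h4
    · intro f hf1 hf2
      rw [← sw_insert, mem_sw] at hf1
      rw [mem_sw] at hf2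
      have := ih f.swap hf1 hf2
      rw [sw_insert, sw_insert, Prod.swap_swap] at this
      exact this

lemma hasM_mono {m N : ℕ} {S T : Finset (Fin N × Fin N)} (hST : S ⊆ T) (h : HasM m N S) :
    HasM m N T := by
  obtain ⟨f, g, hf, hg, hfg⟩ := h
  exact ⟨f, g, hf, hg, fun i => hST (hfg i)⟩

lemma hasM_remove {k N : ℕ} {S T : Finset (Fin N × Fin N)} (h : HasM (k + 1) N S)
    (hT : ∀ p ∈ S, ∀ q ∈ S, p ∉ T → q ∉ T → p.1 = q.1 ∨ p.2 = q.2) : HasM k N T := by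
  obtain ⟨f, g, hf, hg, hfg⟩ := h
  by_cases hex : ∃ i, (f i, g i) ∉ T
  · obtain ⟨i, hi⟩ := hex
    refine ⟨f ∘ i.succAbove, g ∘ i.succAbove, hf.comp Fin.succAbove_right_injective,
      hg.comp Fin.succAbove_right_injective, ?_⟩
    intro j
    by_contra hj
    rcases hT _ (hfg i) _ (hfg (i.succAbove j)) hi hj with h | h
    · exact Fin.succAbove_ne i j (hf h).symm
    · exact Fin.succAbove_ne i j (hg h).symm
  · push Not at hex
    refine ⟨f ∘ Fin.castSucc, g ∘ Fin.castSucc, hf.comp (Fin.castSucc_injective k),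
      hg.comp (Fin.castSucc_injective k), fun j => hex _⟩

lemma hasM_insert {k N : ℕ} {S : Finset (Fin N × Fin N)} {e : Fin N × Fin N}
    (h : HasM (k + 1) N (insert e S)) : HasM k N S := by
  apply hasM_remove h
  intro p hp q hq hp' hq'
  have : p = e := by simpa [hp'] using hp
  have : q = e := by simpa [hq'] using hq
  left; simp [*]

lemma hasM_of_perm {N : ℕ} {S : Finset (Fin N × Fin N)} (σ : Equiv.Perm (Fin N))
    (h : ∀ i, (i, σ i) ∈ S) : HasM N N S :=
  ⟨id, σ, Function.injective_id, σ.injective, h⟩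

lemma counting {m : ℕ} (π : Equiv.Perm (Fin m)) (c : Fin m) (R : Finset (Fin m × Fin m))
    (hR : R.card + 2 = m) (p0 : Fin m × Fin m) (hp0 : p0 ∈ R) (h1 : p0.1 ≠ c)
    (h2 : p0.2 ≠ π c) :
    ∃ y y2, y ≠ c ∧ y2 ≠ c ∧ y ≠ y2 ∧ (c, π y) ∉ R ∧ (y, π c) ∉ R ∧ (c, π y2) ∉ R ∧
      (y2, π c) ∉ R ∧ (y, π y2) ∉ R := by
  by_contra hcon
  push Not at hcon
  have main : ∀ F : Fin m → Fin m × Fin m, (∀ y, y ≠ c → F y ∈ R) →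
      (∀ y z, y ≠ c → z ≠ c → F y = F z → y = z) → False := by
    intro F hF1 hF2
    have := Finset.card_le_card_of_injOn (s := Finset.univ.erase c) (t := R) F
      (by intro y hy; exact hF1 y (by simpa using hy))
      (by intro y hy z hz h; exact hF2 y z (by simpa using hy) (by simpa using hz) h)
    rw [Finset.card_erase_of_mem (Finset.mem_univ _), Finset.card_univ, Fintype.card_fin] at this
    omega
  by_cases hg : ∃ g1 g2, g1 ≠ c ∧ g2 ≠ c ∧ g1 ≠ g2 ∧ (c, π g1) ∉ R ∧ (g1, π c) ∉ R ∧
      (c, π g2) ∉ R ∧ (g2, π c) ∉ R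
  · obtain ⟨g1, g2, a1, a2, a3, a4, a5, a6, a7⟩ := hg
    apply main (fun y => if (c, π y) ∈ R then (c, π y) else if (y, π c) ∈ R then (y, π c)
      else if y = g1 then (y, π g2) else (y, π g1))
    · intro y hy
      have b1 := hcon g1 g2 a1 a2 a3 a4 a5 a6 a7
      have b2 := hcon y g1 hy a1
      split_ifs with c1 c2 c3
      · exact c1
      · exact c2
      · rw [c3]; exact b1
      · exact b2 c3 c1 c2 a4 a5
    · intro y z hy hz h
      have := π.injective.eq_iff (a := y) (b := z)
      split_ifs at h <;> simp only [Prod.mk.injEq] at h <;> grind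
  · push Not at hg
    apply main (fun y => if (c, π y) ∈ R then (c, π y) else if (y, π c) ∈ R then (y, π c)
      else p0)
    · intro y hy
      split_ifs with c1 c2
      · exact c1
      · exact c2
      · exact hp0
    · intro y z hy hz h
      have := π.injective.eq_iff (a := y) (b := z)
      have hgg := hg y z hy hz
      split_ifs at h with c1 c2 c3 c4 c5 c6 c7 c8
      all_goals first
        | (rw [← h] at h1; exact absurd rfl h1)
        | (rw [h] at h1; exact absurd rfl h1)
        | (rw [← h] at h2; exact absurd rfl h2)
        | (rw [h] at h2; exact absurd rfl h2)
        | grind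

lemma finish0 {m : ℕ} {B R : Finset (Fin m × Fin m)} {e : Fin m × Fin m} {c b : Fin m}
    (he1 : e ∉ B) (he2 : e ∉ R) (hI : Inv (insert e B) {c} {b}) (hR : R.card + 2 = m)
    (hcb : (c, b) ∉ R) (hp : ∃ p ∈ R, p.1 ≠ c ∧ p.2 ≠ b)
    (hC : ¬ HasM R.card m (R.filter (fun p => p.2 ≠ b))) : W m m B R := by
  obtain ⟨π, hπ, hB⟩ := hI
  have hb : π c = b := by simpa using hπ c
  subst hb
  obtain ⟨p0, hp0, hp1, hp2⟩ := hp
  obtain ⟨y, y2, hy, hy2, hyy, r1, r2, r3, r4, r5⟩ := counting π c R hR p0 hp0 hp1 hp2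
  simp only [Finset.mem_singleton] at hB
  have inj : ∀ u v, π u = π v ↔ u = v := fun u v => π.injective.eq_iff
  have hno : ∀ z, ¬ HasM (R.card + 1) m (insert (z, π c) (insert (c, π c) R)) := by
    intro z hz
    apply hC
    apply hasM_remove hz
    intro p hp q hq hp' hq'
    right
    have aux : ∀ p ∈ insert (z, π c) (insert (c, π c) R),
        p ∉ R.filter (fun p => p.2 ≠ π c) → p.2 = π c := by
      intro p hp hp'
      rcases Finset.mem_insert.1 hp with h | h
      · rw [h]
      · rcases Finset.mem_insert.1 h with h | h
        · rw [h]
        · by_contra hne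
          exact hp' (Finset.mem_filter.2 ⟨h, hne⟩)
    rw [aux p hp hp', aux q hq hq']
  have hno1 : ¬ HasM (R.card + 1) m (insert (c, π c) R) := by
    intro h; apply hno c; simpa using h
  -- first move
  refine W.step e (c, π c) he1 he2 (by rw [hB]; simp) hcb ?_
  intro f hf1 hf2
  by_cases hfc : f = (c, π c)
  swap
  · refine W.win (c, π c) (by rw [hB]; simp) (by simp [hcb, Ne.symm hfc]) ?_ ?_
    · apply hasM_of_perm π
      intro i
      rw [Finset.mem_insert, hB]
      by_cases hi : i = c
      · left; rw [hi]
      · right; exact ⟨hi, rfl⟩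
    · intro h
      have := hasM_card h
      have := Finset.card_insert_le f R
      omega
  subst hfc
  have hm : m = R.card + 1 + 1 := by omega
  generalize hB1 : insert e B = B1 at *
  -- second move
  refine W.step (c, π y) (y, π c) (by rw [hB]; simp) (by simp [r1, inj, hy])
    (by rw [Finset.mem_insert, hB]; simp [inj, hy, Ne.symm hy]) (by simp [r2, hy]) ?_
  intro f hf1 hf2
  by_cases hfc : f = (y, π c)
  swap
  · refine W.win (y, π c) (by rw [Finset.mem_insert, hB]; simp [inj, hy, Ne.symm hy])
      (by simp [r2, Ne.symm hfc, hy]) ?_ ?_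
    · apply hasM_of_perm ((Equiv.swap c y).trans π)
      intro i
      rw [Finset.mem_insert, Finset.mem_insert, hB]
      simp only [Equiv.trans_apply, Equiv.swap_apply_def, Prod.mk.injEq]
      split_ifs with i1 i2
      · right; left; exact ⟨i1, rfl⟩
      · left; exact ⟨i2, rfl⟩
      · right; right; exact ⟨i1, rfl⟩
    · intro h
      apply hno1
      apply hasM_insert (e := f)
      rwa [← hm]
  subst hfc
  refine W.step (y2, π c) (c, π y2) ?_ ?_ ?_ ?_ ?_
  · simp only [Finset.mem_insert, hB, Prod.mk.injEq, inj]; grind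
  · simp only [Finset.mem_insert, Prod.mk.injEq, inj]; grind
  · simp only [Finset.mem_insert, hB, Prod.mk.injEq, inj]; grind
  · simp only [Finset.mem_insert, Prod.mk.injEq, inj]; grind
  intro f hf1 hf2
  have hnoF : ¬ HasM m m (insert f (insert (y, π c) (insert (c, π c) R))) := by
    intro h
    apply hno y
    apply hasM_insert (e := f)
    rwa [← hm]
  by_cases hfc : f = (c, π y2)
  · refine W.win (y, π y2) ?_ ?_ ?_ hnoF
    · simp only [Finset.mem_insert, hB, Prod.mk.injEq, inj]; grind
    · rw [hfc]; simp only [Finset.mem_insert, Prod.mk.injEq, inj]; grind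
    · apply hasM_of_perm (((Equiv.swap y y2).trans (Equiv.swap c y)).trans π)
      intro i
      simp only [Finset.mem_insert, hB, Prod.mk.injEq, Equiv.trans_apply,
        Equiv.swap_apply_def, inj]
      split_ifs <;> grind
  · refine W.win (c, π y2) ?_ ?_ ?_ hnoF
    · simp only [Finset.mem_insert, hB, Prod.mk.injEq, inj]; grind
    · simp only [Finset.mem_insert, Prod.mk.injEq, inj]; grind
    · apply hasM_of_perm ((Equiv.swap c y2).trans π)
      intro i
      simp only [Finset.mem_insert, hB, Prod.mk.injEq, Equiv.trans_apply,
        Equiv.swap_apply_def, inj]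
      split_ifs <;> grind

def NM {m : ℕ} (R : Finset (Fin m × Fin m)) : Prop :=
  ∃ p ∈ R, ∃ q ∈ R, p ≠ q ∧ (p.1 = q.1 ∨ p.2 = q.2)

lemma not_hasM_of_NM {m : ℕ} {R : Finset (Fin m × Fin m)} (h : NM R) : ¬ HasM R.card m R := by
  rintro ⟨f, g, hf, hg, hfg⟩
  have himg : Finset.univ.image (fun i => (f i, g i)) = R := by
    apply Finset.eq_of_subset_of_card_le
    · intro p hp
      obtain ⟨i, -, rfl⟩ := Finset.mem_image.1 hp
      exact hfg i
    · rw [Finset.card_image_of_injective]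
      · simp
      · intro i j hij
        exact hf (Prod.mk.inj hij).1
  obtain ⟨p, hp, q, hq, hne, h⟩ := h
  rw [← himg] at hp hq
  obtain ⟨i, -, rfl⟩ := Finset.mem_image.1 hp
  obtain ⟨j, -, rfl⟩ := Finset.mem_image.1 hq
  apply hne
  rcases h with h | h
  · rw [hf h]
  · rw [hg h]

lemma finish1 {m : ℕ} {B R : Finset (Fin m × Fin m)} {a1 a2 b1 b2 : Fin m}
    (ha : a1 ≠ a2) (hb : b1 ≠ b2) (hI : Inv B {a1, a2} {b1, b2}) (hR : R.card + 2 = m)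
    (r1 : (a1, b2) ∉ R) (r2 : (a2, b1) ∉ R) (hp : ∃ p ∈ R, p.1 ≠ a2 ∧ p.2 ≠ b1)
    (hC : NM R ∨ ∃ p ∈ R, p.2 = b1) : W m m B R := by
  have hI' := hI.play (a := a1) (b := b2) (by simp) (by simp)
  have e1 : ({a1, a2} : Finset (Fin m)).erase a1 = {a2} := by ext x; simp; grind
  have e2 : ({b1, b2} : Finset (Fin m)).erase b2 = {b1} := by ext x; simp; grind
  rw [e1, e2] at hI'
  refine finish0 ?_ r1 hI' hR r2 hp ?_
  · obtain ⟨π, -, h⟩ := hI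
    rw [h]; simp
  · rcases hC with h | ⟨p, hp, hpb⟩
    · intro h'
      exact not_hasM_of_NM h (hasM_mono (Finset.filter_subset _ _) h')
    · intro h'
      have h1 := hasM_card h'
      have h2 : (R.filter (fun p => p.2 ≠ b1)).card < R.card := by
        apply Finset.card_lt_card
        rw [Finset.filter_ssubset]
        exact ⟨p, hp, by simpa using hpb⟩
      omega

def Ok {m : ℕ} (R : Finset (Fin m × Fin m)) (a1 a2 b1 b2 : Fin m) : Prop :=
  (a1, b2) ∉ R ∧ (a2, b1) ∉ R ∧ (∃ p ∈ R, p.1 ≠ a2 ∧ p.2 ≠ b1) ∧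
    (NM R ∨ ∃ p ∈ R, p.1 = a2 ∨ p.2 = b1)

lemma finish2 {m : ℕ} {B R : Finset (Fin m × Fin m)} {a1 a2 b1 b2 : Fin m}
    (ha : a1 ≠ a2) (hb : b1 ≠ b2) (hI : Inv B {a1, a2} {b1, b2}) (hR : R.card + 2 = m)
    (hok : Ok R a1 a2 b1 b2) : W m m B R := by
  obtain ⟨r1, r2, ⟨p, hp, hp1, hp2⟩, hC⟩ := hok
  by_cases hC' : NM R ∨ ∃ p ∈ R, p.2 = b1
  · exact finish1 ha hb hI hR r1 r2 ⟨p, hp, hp1, hp2⟩ hC'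
  · have hq : ∃ q ∈ R, q.1 = a2 := by grind
    obtain ⟨q, hq, hq1⟩ := hq
    have : W m m (sw B) (sw R) := by
      refine finish1 (a1 := b2) (a2 := b1) (b1 := a2) (b2 := a1) hb.symm ha.symm ?_ ?_ ?_ ?_ ?_ ?_
      · have := hI.swap
        rw [Finset.pair_comm b1, Finset.pair_comm a1] at this
        exact this
      · rw [Finset.card_map]; exact hR
      · rw [mem_sw]; exact r1
      · rw [mem_sw]; exact r2
      · exact ⟨p.swap, by rw [mem_sw, Prod.swap_swap]; exact hp, hp2, hp1⟩
      · right; exact ⟨q.swap, by rw [mem_sw, Prod.swap_swap]; exact hq, hq1⟩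
    have := W_sw this
    rwa [sw_sw, sw_sw] at this

lemma labelling {m : ℕ} {R : Finset (Fin m × Fin m)} {a1 a2 b1 b2 : Fin m}
    (ha : a1 ≠ a2) (hb : b1 ≠ b2) (hR : 2 ≤ R.card)
    (hu : ∀ p ∈ R, ∀ q ∈ R, (p.1 = a1 ∨ p.1 = a2) → (p.2 = b1 ∨ p.2 = b2) →
      (q.1 = a1 ∨ q.1 = a2) → (q.2 = b1 ∨ q.2 = b2) → p = q)
    (hs : ∃ p ∈ R, (p.1 = a1 ∨ p.1 = a2) ∨ (p.2 = b1 ∨ p.2 = b2)) :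
    Ok R a1 a2 b1 b2 ∨ Ok R a2 a1 b1 b2 ∨ Ok R a1 a2 b2 b1 ∨ Ok R a2 a1 b2 b1 := by
  obtain ⟨s, hs, hs'⟩ := hs
  obtain ⟨q, hq, hqs⟩ := Finset.exists_mem_ne (by omega : 1 < R.card) s
  obtain ⟨s1, s2⟩ := s
  obtain ⟨q1, q2⟩ := q
  have u1 : (a1, b1) ∈ R → (a1, b2) ∉ R ∧ (a2, b1) ∉ R := fun h =>
    ⟨fun h' => by have := hu _ h _ h'; simp_all, fun h' => by have := hu _ h _ h'; simp_all⟩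
  have u2 : (a2, b2) ∈ R → (a1, b2) ∉ R ∧ (a2, b1) ∉ R := fun h =>
    ⟨fun h' => by have := hu _ h _ h'; simp_all, fun h' => by have := hu _ h _ h'; simp_all⟩
  have huq := hu _ hs _ hq
  clear hu hR
  by_cases hnm : NM R
  · have k1 : ∀ c b, (s1 ≠ c ∧ s2 ≠ b) ∨ (q1 ≠ c ∧ q2 ≠ b) → ∃ p ∈ R, p.1 ≠ c ∧ p.2 ≠ b := by
      intro c b h
      rcases h with h | h
      · exact ⟨_, hs, h⟩
      · exact ⟨_, hq, h⟩
    have := k1 a1 b1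
    have := k1 a1 b2
    have := k1 a2 b1
    have := k1 a2 b2
    simp only [Ok, hnm, true_or, and_true]
    clear k1
    grind
  · have hm : ∀ p ∈ R, ∀ p' ∈ R, p.1 = p'.1 ∨ p.2 = p'.2 → p = p' := by
      intro p hp p' hp' h
      by_contra hne
      exact hnm ⟨p, hp, p', hp', hne, h⟩
    have m1 := hm _ hs _ hq
    have n1 : ∀ c b, (c, b) ∈ R → (s1 = c ∨ s2 = b) → s1 = c ∧ s2 = b := by
      intro c b h h'
      have := hm _ hs _ h h'
      simpa using this
    have n2 : ∀ c b, (c, b) ∈ R → (q1 = c ∨ q2 = b) → q1 = c ∧ q2 = b := by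
      intro c b h h'
      have := hm _ hq _ h h'
      simpa using this
    have key : ∀ c1 c2 d1 d2, (c1, d2) ∉ R → (c2, d1) ∉ R →
        ((s1 ≠ c2 ∧ s2 ≠ d1) ∧ (q1 = c2 ∨ q2 = d1)) ∨
        ((q1 ≠ c2 ∧ q2 ≠ d1) ∧ (s1 = c2 ∨ s2 = d1)) → Ok R c1 c2 d1 d2 := by
      intro c1 c2 d1 d2 h1 h2 h
      rcases h with ⟨h, h'⟩ | ⟨h, h'⟩
      · exact ⟨h1, h2, ⟨_, hs, h⟩, Or.inr ⟨_, hq, h'⟩⟩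
      · exact ⟨h1, h2, ⟨_, hq, h⟩, Or.inr ⟨_, hs, h'⟩⟩
    have k1 := key a1 a2 b1 b2
    have k2 := key a2 a1 b1 b2
    have k3 := key a1 a2 b2 b1
    have k4 := key a2 a1 b2 b1
    have x1 := n1 a1 b1
    have x2 := n1 a1 b2
    have x3 := n1 a2 b1
    have x4 := n1 a2 b2
    have y1 := n2 a1 b1
    have y2 := n2 a1 b2
    have y3 := n2 a2 b1
    have y4 := n2 a2 b2
    clear key n1 n2 hm hnm
    generalize Ok R a1 a2 b1 b2 = O1 at *
    generalize Ok R a2 a1 b1 b2 = O2 at *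
    generalize Ok R a1 a2 b2 b1 = O3 at *
    generalize Ok R a2 a1 b2 b1 = O4 at *
    simp only [ne_eq, Prod.mk.injEq] at *
    generalize ((a1, b1) ∈ R) = P1 at *
    generalize ((a1, b2) ∈ R) = P2 at *
    generalize ((a2, b1) ∈ R) = P3 at *
    generalize ((a2, b2) ∈ R) = P4 at *
    clear hs hq
    by_cases P2 <;> by_cases P3 <;> by_cases P1 <;> by_cases P4 <;>
      by_cases q1 = a1 <;> by_cases q2 = b1 <;> by_cases q1 = a2 <;> by_cases q2 = b2 <;>
      grind (splits := 40)

lemma stepChoice {m : ℕ} {R : Finset (Fin m × Fin m)} {Ar Bc : Finset (Fin m)}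
    (hA : 2 ≤ Ar.card) (hB : 2 ≤ Bc.card)
    (hu : ∀ p ∈ R, ∀ q ∈ R, p.1 ∈ Ar → p.2 ∈ Bc → q.1 ∈ Ar → q.2 ∈ Bc → p = q)
    (hs : ∃ p ∈ R, p.1 ∈ Ar ∨ p.2 ∈ Bc) :
    ∃ a ∈ Ar, ∃ b ∈ Bc, (a, b) ∉ R ∧
      (∀ p ∈ R, ¬ (p.1 ∈ Ar.erase a ∧ p.2 ∈ Bc.erase b)) ∧
      ∃ p ∈ R, p.1 ∈ Ar.erase a ∨ p.2 ∈ Bc.erase b := by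
  by_cases hr : ∃ p ∈ R, p.1 ∈ Ar ∧ p.2 ∈ Bc
  · obtain ⟨p, hp, hp1, hp2⟩ := hr
    obtain ⟨b, hb, hne⟩ := Finset.exists_mem_ne (by omega : 1 < Bc.card) p.2
    refine ⟨p.1, hp1, b, hb, ?_, ?_, p, hp, Or.inr (Finset.mem_erase.2 ⟨hne.symm, hp2⟩)⟩
    · intro h
      have := hu p hp _ h hp1 hp2 hp1 hb
      apply hne
      rw [this]
    · rintro q hq ⟨h1, h2⟩
      rw [Finset.mem_erase] at h1 h2
      have := hu p hp q hq hp1 hp2 h1.2 h2.2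
      apply h1.1
      rw [this]
  · push Not at hr
    obtain ⟨p, hp, h⟩ := hs
    obtain ⟨a, ha, hne⟩ := Finset.exists_mem_ne (by omega : 1 < Ar.card) p.1
    obtain ⟨b, hb, hne'⟩ := Finset.exists_mem_ne (by omega : 1 < Bc.card) p.2
    refine ⟨a, ha, b, hb, fun h => hr _ h ha hb, ?_, p, hp, ?_⟩
    · rintro q hq ⟨h1, h2⟩
      exact hr q hq (Finset.mem_of_mem_erase h1) (Finset.mem_of_mem_erase h2)
    · rcases h with h | h
      · exact Or.inl (Finset.mem_erase.2 ⟨hne.symm, h⟩)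
      · exact Or.inr (Finset.mem_erase.2 ⟨hne'.symm, h⟩)

lemma loop {m : ℕ} (hm : 4 ≤ m) (k : ℕ) : ∀ (B R : Finset (Fin m × Fin m))
    (Ar Bc : Finset (Fin m)), Inv B Ar Bc → Ar.card = k + 2 → Bc.card = k + 2 →
    R.card + (k + 2) = m →
    (∀ p ∈ R, ∀ q ∈ R, p.1 ∈ Ar → p.2 ∈ Bc → q.1 ∈ Ar → q.2 ∈ Bc → p = q) →
    (∃ p ∈ R, p.1 ∈ Ar ∨ p.2 ∈ Bc) → W m m B R := by
  induction k with
  | zero =>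
    intro B R Ar Bc hI hA hB hR hu hs
    obtain ⟨a1, a2, ha, rfl⟩ := Finset.card_eq_two.1 hA
    obtain ⟨b1, b2, hb, rfl⟩ := Finset.card_eq_two.1 hB
    simp only [Finset.mem_insert, Finset.mem_singleton] at hu hs
    rcases labelling ha hb (by omega) hu hs with h | h | h | h
    · exact finish2 ha hb hI (by omega) h
    · rw [Finset.pair_comm a1] at hI
      exact finish2 ha.symm hb hI (by omega) h
    · rw [Finset.pair_comm b1] at hI
      exact finish2 ha hb.symm hI (by omega) h
    · rw [Finset.pair_comm a1, Finset.pair_comm b1] at hI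
      exact finish2 ha.symm hb.symm hI (by omega) h
  | succ k ih =>
    intro B R Ar Bc hI hA hB hR hu hs
    obtain ⟨a, ha, b, hb, hab, hfree, p, hp, hps⟩ :=
      stepChoice (by omega) (by omega) hu hs
    have hA' : (Ar.erase a).card = k + 2 := by rw [Finset.card_erase_of_mem ha]; omega
    have hB' : (Bc.erase b).card = k + 2 := by rw [Finset.card_erase_of_mem hb]; omega
    have hI' := hI.play ha hb
    obtain ⟨x, hx⟩ := Finset.card_pos.1 (by omega : 0 < (Ar.erase a).card)
    obtain ⟨y, hy⟩ := Finset.card_pos.1 (by omega : 0 < (Bc.erase b).card)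
    refine W.step (a, b) (x, y) ?_ hab ?_ (fun h => hfree _ h ⟨hx, hy⟩) ?_
    · obtain ⟨π, -, h⟩ := hI
      rw [h]; exact fun h => h.1 ha
    · obtain ⟨π, -, h⟩ := hI'
      rw [h]; exact fun h => h.1 hx
    · intro f hf1 hf2
      refine ih _ _ _ _ hI' hA' hB' ?_ ?_ ⟨p, Finset.mem_insert_of_mem hp, hps⟩
      · rw [Finset.card_insert_of_notMem hf2]; omega
      · have aux : ∀ p ∈ insert f R, p.1 ∈ Ar.erase a → p.2 ∈ Bc.erase b → p = f := by
          intro p hp h1 h2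
          rcases Finset.mem_insert.1 hp with h | h
          · exact h
          · exact absurd ⟨h1, h2⟩ (hfree p h)
        intro p hp q hq h1 h2 h3 h4
        rw [aux p hp h1 h2, aux q hq h3 h4]

lemma Wmain {m : ℕ} (hm : 4 ≤ m) : W m m ∅ ∅ := by
  have hI : Inv (∅ : Finset (Fin m × Fin m)) Finset.univ Finset.univ := ⟨1, by simp, by simp⟩
  let z : Fin m := ⟨0, by omega⟩
  let o : Fin m := ⟨1, by omega⟩
  have hI' := hI.play (Finset.mem_univ z) (Finset.mem_univ z)
  refine W.step (z, z) (o, o) (by simp) (by simp) (by simp [z, o]) (by simp) ?_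
  intro f hf1 _
  have hc : (Finset.univ.erase z).card = (m - 3) + 2 := by
    rw [Finset.card_erase_of_mem (Finset.mem_univ _), Finset.card_univ, Fintype.card_fin]; omega
  refine loop hm (m - 3) _ _ _ _ hI' hc hc ?_ ?_ ⟨f, by simp, ?_⟩
  · simp; omega
  · intro p hp q hq _ _ _ _
    simp at hp hq
    rw [hp, hq]
  · simp only [Finset.mem_erase, Finset.mem_univ, and_true]
    by_contra h
    push Not at h
    apply hf1
    simp [Prod.ext_iff, h.1, h.2]

end AGProof

/-- For every integer `n ≥ 1`, the bipartite achievement number of the disjoint union of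
an edge and an `n`-edge matching satisfies `ba(K_{1,1} ∪ nK₂) = n + 2` if `n = 1` or
`n = 2`, and `ba(K_{1,1} ∪ nK₂) = n + 1` if `n ≥ 3`: the least `N` for which Alice has a
winning strategy in `(K_{1,1} ∪ nK₂, K_{N,N}, +)` is that value. -/
theorem stmt17 (n : ℕ) (hn : 1 ≤ n) :
    IsLeast {N : ℕ | AliceWins (starMatching 1 n)
        (completeBipartiteGraph (Fin N) (Fin N))}
      (if n = 1 ∨ n = 2 then n + 2 else n + 1) := by
  by_cases h : n = 1 ∨ n = 2
  · rw [if_pos h]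
    constructor
    · rcases h with rfl | rfl
      · exact AGProof.aliceWins_of_W (by norm_num) AGProof.W23
      · exact AGProof.aliceWins_of_W (by norm_num) AGProof.W34
    · intro N hN
      have h1 := AGProof.hasCopy_le hN
      by_contra hlt
      have hNe : N = n + 1 := by omega
      subst hNe
      rcases h with rfl | rfl
      · exact AGProof.not_aliceWins_of_D (K := 2) (by norm_num) AGProof.D2 hN
      · exact AGProof.not_aliceWins_of_D (K := 5) (by norm_num) AGProof.D3 hN
  · rw [if_neg h]
    constructor
    · have h4 : 4 ≤ n + 1 := by omega
      exact AGProof.aliceWins_of_W (Nat.succ_pos n) (AGProof.Wmain h4)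
    · intro N hN
      exact AGProof.hasCopy_le hN
end

section
/- Let m ≥ 2 and n ≥ 1 be integers such that m ≤ 4 or n ≥ m − 2. Then the bipartite achievement number of the disjoint union of a star and a matching satisfies ba(K_{1,m} ∪ nK_2) = m + n. -/
open AchievementGame


open AchievementGame

namespace SMG
open Finset

/-- Winning positions (Alice to move) of the abstract game on cells, with goal predicate `Q`. -/
inductive W {C : Type} [DecidableEq C] (Q : Finset C → Prop) : Finset C → Finset C → Prop
  | win (B R : Finset C) (e : C) : e ∉ B → e ∉ R → Q (insert e B) → W Q B R
  | step' (B R : Finset C) (e f0 : C) : e ∉ B → e ∉ R → f0 ∉ insert e B → f0 ∉ R →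
      (∀ f, f ∉ insert e B → f ∉ R → ¬ Q (insert f R)) →
      (∀ f, f ∉ insert e B → f ∉ R → W Q (insert e B) (insert f R)) → W Q B R

theorem W.step {C : Type} [DecidableEq C] {Q : Finset C → Prop} (B R : Finset C) (e f0 : C)
    (h1 : e ∉ B) (h2 : e ∉ R) (h3 : f0 ∉ insert e B) (h4 : f0 ∉ R)
    (h : ∀ f, f ∉ insert e B → f ∉ R → ¬ Q (insert f R) ∧ W Q (insert e B) (insert f R)) :
    W Q B R :=
  W.step' B R e f0 h1 h2 h3 h4 (fun f a b => (h f a b).1) (fun f a b => (h f a b).2)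

/-- A good move in a position. -/
def Good {C : Type} [DecidableEq C] (Q : Finset C → Prop) (B R : Finset C) (e : C) : Prop :=
  e ∉ B ∧ e ∉ R ∧ (Q (insert e B) ∨ ((∃ f, f ∉ insert e B ∧ f ∉ R) ∧
    ∀ f, f ∉ insert e B → f ∉ R → ¬ Q (insert f R) ∧ W Q (insert e B) (insert f R)))

theorem W.good {C : Type} [DecidableEq C] {Q : Finset C → Prop} {B R : Finset C}
    (h : W Q B R) : ∃ e, Good Q B R e := by
  rcases h with ⟨_, _, e, h1, h2, h3⟩ | ⟨_, _, e, f0, h1, h2, h3, h4, h5, h6⟩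
  · exact ⟨e, h1, h2, Or.inl h3⟩
  · exact ⟨e, h1, h2, Or.inr ⟨⟨f0, h3, h4⟩, fun f a b => ⟨h5 f a b, h6 f a b⟩⟩⟩

theorem W.free {C : Type} [DecidableEq C] {Q : Finset C → Prop} {B R : Finset C}
    (h : W Q B R) : ∃ e, e ∉ B ∧ e ∉ R := by
  obtain ⟨e, h1, h2, _⟩ := h.good
  exact ⟨e, h1, h2⟩

/-- Step where Bob is also allowed to pass. -/
theorem W.pass {C : Type} [DecidableEq C] {Q : Finset C → Prop} {B R : Finset C} (e : C)
    (h1 : e ∉ B) (h2 : e ∉ R)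
    (h : ∀ R', R ⊆ R' → R'.card ≤ R.card + 1 → Disjoint (insert e B) R' →
      ¬ Q R' ∧ W Q (insert e B) R') (hd : Disjoint B R) : W Q B R := by
  have hd' : Disjoint (insert e B) R := by
    rw [disjoint_insert_left]; exact ⟨h2, hd⟩
  obtain ⟨f0, h3, h4⟩ := (h R subset_rfl (by omega) hd').2.free
  refine W.step B R e f0 h1 h2 h3 h4 fun f hf1 hf2 => ?_
  apply h _ (subset_insert _ _) (card_insert_le _ _)
  rw [disjoint_insert_right]
  exact ⟨hf1, hd'⟩

/-- Transport along a symmetry. -/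
theorem W.map {C : Type} [DecidableEq C] {Q : Finset C → Prop} (φ : C ≃ C)
    (hQ : ∀ B, Q B → Q (B.image φ)) (hQ' : ∀ B, Q (B.image φ) → Q B) {B R : Finset C}
    (h : W Q B R) : W Q (B.image φ) (R.image φ) := by
  induction h with
  | win B R e h1 h2 h3 =>
    refine W.win _ _ (φ e) (by simpa using h1) (by simpa using h2) ?_
    rw [← image_insert]; exact hQ _ h3
  | step' B R e f0 h1 h2 h3 h4 h5 h6 ih =>
    refine W.step _ _ (φ e) (φ f0) (by simpa using h1) (by simpa using h2) ?_
      (by simpa using h4) ?_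
    · rw [← image_insert]; simpa using h3
    · intro f hf1 hf2
      obtain ⟨g, rfl⟩ := φ.surjective f
      rw [← image_insert] at hf1 ⊢
      have a1 : g ∉ insert e B := by simpa using hf1
      have a2 : g ∉ R := by simpa using hf2
      rw [← image_insert]
      exact ⟨fun hq => h5 g a1 a2 (hQ' _ hq), ih g a1 a2⟩

abbrev Cell (N : ℕ) := Fin N × Fin N

def edge {N : ℕ} (c : Cell N) : Sym2 (Fin N ⊕ Fin N) := s(Sum.inl c.1, Sum.inr c.2)

theorem edge_inj {N : ℕ} : Function.Injective (edge (N := N)) := by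
  intro a b h
  simp [edge] at h
  exact Prod.ext h.1 h.2

theorem edge_mem {N : ℕ} (c : Cell N) :
    edge c ∈ (completeBipartiteGraph (Fin N) (Fin N)).edgeSet := by
  simp [edge]

theorem exists_edge {N : ℕ} (e : Sym2 (Fin N ⊕ Fin N))
    (h : e ∈ (completeBipartiteGraph (Fin N) (Fin N)).edgeSet) : ∃ c : Cell N, e = edge c := by
  induction e using Sym2.ind with
  | _ x y =>
    rcases x with x | x <;> rcases y with y | y <;> simp at h
    · exact ⟨(x, y), rfl⟩
    · exact ⟨(y, x), by rw [edge, Sym2.eq_swap]⟩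

theorem hist_length {α : Type*} (σ τ : Strategy α) (t : ℕ) : (hist σ τ t).length = t := by
  induction t with
  | zero => rfl
  | succ t ih => simp [hist, ih]

theorem hist_succ {α : Type*} (σ τ : Strategy α) (t : ℕ) :
    hist σ τ (t + 1) = hist σ τ t ++ [move σ τ t] := rfl

theorem mem_hist {α : Type*} (σ τ : Strategy α) (t : ℕ) (e : Sym2 α) :
    e ∈ hist σ τ t ↔ ∃ i < t, e = move σ τ i := by
  induction t with
  | zero => simp [hist]
  | succ t ih =>
    rw [hist_succ, List.mem_append, ih]
    simp only [List.mem_singleton]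
    constructor
    · rintro (⟨i, hi, h⟩ | h)
      · exact ⟨i, by omega, h⟩
      · exact ⟨t, by omega, h⟩
    · rintro ⟨i, hi, h⟩
      rcases Nat.lt_succ_iff_lt_or_eq.1 hi with h' | rfl
      · exact Or.inl ⟨i, h', h⟩
      · exact Or.inr h

theorem hist_get {α : Type*} (σ τ : Strategy α) (t i : ℕ) (h : i < t) :
    (hist σ τ t)[i]? = some (move σ τ i) := by
  induction t with
  | zero => omega
  | succ t ih =>
    rw [hist_succ, List.getElem?_append, hist_length]
    by_cases h' : i < t
    · rw [if_pos h', ih h']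
    · have : i = t := by omega
      subst this
      simp

/-- As long as the board is not full, the moves played form distinct edges. -/
theorem hist_inv {α : Type*} {G : SimpleGraph α}
    {σ τ : Strategy α} (hσ : σ.Valid G) (hτ : τ.Valid G) (t : ℕ) (ht : t ≤ G.edgeSet.ncard) :
    (hist σ τ t).Nodup ∧ ∀ e ∈ hist σ τ t, e ∈ G.edgeSet := by
  classical
  induction t with
  | zero => simp [hist]
  | succ t ih =>
    obtain ⟨h1, h2⟩ := ih (by omega)
    have hex : ∃ e ∈ G.edgeSet, e ∉ hist σ τ t := by
      by_contra hcon
      push Not at hcon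
      have : G.edgeSet ⊆ ((hist σ τ t).toFinset : Set (Sym2 α)) := by
        intro e he
        simpa using hcon e he
      have := Set.ncard_le_ncard this (Finset.finite_toSet _)
      rw [Set.ncard_coe_finset] at this
      have h3 := List.toFinset_card_le (hist σ τ t)
      rw [hist_length] at h3
      omega
    have hm : move σ τ t ∈ G.edgeSet ∧ move σ τ t ∉ hist σ τ t := by
      unfold move
      split_ifs
      · exact hσ _ hex
      · exact hτ _ hex
    rw [hist_succ]
    refine ⟨?_, ?_⟩
    · rw [List.nodup_append]
      refine ⟨h1, by simp, ?_⟩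
      intro a ha b hb
      simp at hb
      subst hb
      rintro rfl
      exact hm.2 ha
    · intro e he
      rw [List.mem_append, List.mem_singleton] at he
      rcases he with he | rfl
      · exact h2 e he
      · exact hm.1

theorem length_le {α : Type*} {G : SimpleGraph α} (hfin : G.edgeSet.Finite)
    (l : List (Sym2 α)) (h1 : l.Nodup) (h2 : ∀ e ∈ l, e ∈ G.edgeSet) :
    l.length ≤ G.edgeSet.ncard := by
  classical
  rw [← List.toFinset_card_of_nodup h1, ← Set.ncard_coe_finset]
  apply Set.ncard_le_ncard _ hfin
  intro e he
  exact h2 e (by simpa using he)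

open Classical in
/-- Blue cells of a history. -/
noncomputable def blues {N : ℕ} (l : List (Sym2 (Fin N ⊕ Fin N))) : Finset (Cell N) :=
  univ.filter fun c => ∃ i, l[2 * i]? = some (edge c)

open Classical in
/-- Red cells of a history. -/
noncomputable def reds {N : ℕ} (l : List (Sym2 (Fin N ⊕ Fin N))) : Finset (Cell N) :=
  univ.filter fun c => ∃ i, l[2 * i + 1]? = some (edge c)

open Classical in
/-- Alice's strategy. -/
noncomputable def strat {N : ℕ} (Q : Finset (Cell N) → Prop) (e0 : Cell N) :
    Strategy (Fin N ⊕ Fin N) := fun l =>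
  if h : ∃ e, Good Q (blues l) (reds l) e then edge h.choose
  else if h : ∃ e ∈ (completeBipartiteGraph (Fin N) (Fin N)).edgeSet, e ∉ l then h.choose
  else edge e0

theorem not_mem_of {N : ℕ} (l : List (Sym2 (Fin N ⊕ Fin N))) (c : Cell N)
    (h1 : c ∉ blues l) (h2 : c ∉ reds l) : edge c ∉ l := by
  intro h
  obtain ⟨i, hi⟩ := List.mem_iff_getElem?.1 h
  rcases Nat.even_or_odd' i with ⟨k, rfl | rfl⟩
  · exact h1 (by simp only [blues, mem_filter, mem_univ, true_and]; exact ⟨k, hi⟩)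
  · exact h2 (by simp only [reds, mem_filter, mem_univ, true_and]; exact ⟨k, hi⟩)

theorem strat_good {N : ℕ} (Q : Finset (Cell N) → Prop) (e0 : Cell N)
    (l : List (Sym2 (Fin N ⊕ Fin N))) (h : ∃ e, Good Q (blues l) (reds l) e) :
    strat Q e0 l = edge h.choose := by
  unfold strat
  rw [dif_pos h]

theorem strat_valid {N : ℕ} (Q : Finset (Cell N) → Prop) (e0 : Cell N) :
    (strat Q e0).Valid (completeBipartiteGraph (Fin N) (Fin N)) := by
  intro l hl
  unfold strat
  by_cases h : ∃ e, Good Q (blues l) (reds l) e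
  · rw [dif_pos h]
    exact ⟨edge_mem _, not_mem_of _ _ h.choose_spec.1 h.choose_spec.2.1⟩
  · rw [dif_neg h, dif_pos hl]
    exact hl.choose_spec

theorem blues_succ {N : ℕ} (σ τ : Strategy (Fin N ⊕ Fin N)) (j : ℕ) (c : Cell N)
    (hc : move σ τ (2 * j) = edge c) :
    blues (hist σ τ (2 * (j + 1))) = insert c (blues (hist σ τ (2 * j))) := by
  ext d
  simp only [blues, mem_filter, mem_univ, true_and, mem_insert]
  constructor
  · rintro ⟨i, hi⟩
    have hlt : 2 * i < 2 * (j + 1) := by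
      by_contra hcon
      rw [List.getElem?_eq_none (by rw [hist_length]; omega)] at hi
      simp at hi
    rw [hist_get _ _ _ _ hlt] at hi
    by_cases hij : i = j
    · subst hij
      rw [hc] at hi
      left
      exact (edge_inj (Option.some.inj hi)).symm
    · right
      exact ⟨i, by rw [hist_get _ _ _ _ (by omega)]; exact hi⟩
  · rintro (rfl | ⟨i, hi⟩)
    · exact ⟨j, by rw [hist_get _ _ _ _ (by omega), hc]⟩
    · have hlt : 2 * i < 2 * j := by
        by_contra hcon
        rw [List.getElem?_eq_none (by rw [hist_length]; omega)] at hi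
        simp at hi
      rw [hist_get _ _ _ _ hlt] at hi
      exact ⟨i, by rw [hist_get _ _ _ _ (by omega)]; exact hi⟩

theorem reds_succ {N : ℕ} (σ τ : Strategy (Fin N ⊕ Fin N)) (j : ℕ) (c : Cell N)
    (hc : move σ τ (2 * j + 1) = edge c) :
    reds (hist σ τ (2 * (j + 1))) = insert c (reds (hist σ τ (2 * j))) := by
  ext d
  simp only [reds, mem_filter, mem_univ, true_and, mem_insert]
  constructor
  · rintro ⟨i, hi⟩
    have hlt : 2 * i + 1 < 2 * (j + 1) := by
      by_contra hcon
      rw [List.getElem?_eq_none (by rw [hist_length]; omega)] at hi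
      simp at hi
    rw [hist_get _ _ _ _ hlt] at hi
    by_cases hij : i = j
    · subst hij
      rw [hc] at hi
      left
      exact (edge_inj (Option.some.inj hi)).symm
    · right
      exact ⟨i, by rw [hist_get _ _ _ _ (by omega)]; exact hi⟩
  · rintro (rfl | ⟨i, hi⟩)
    · exact ⟨j, by rw [hist_get _ _ _ _ (by omega), hc]⟩
    · have hlt : 2 * i + 1 < 2 * j := by
        by_contra hcon
        rw [List.getElem?_eq_none (by rw [hist_length]; omega)] at hi
        simp at hi
      rw [hist_get _ _ _ _ hlt] at hi
      exact ⟨i, by rw [hist_get _ _ _ _ (by omega)]; exact hi⟩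

theorem hasCopy_mono {α β : Type*} {F : SimpleGraph β} {s t : Set (Sym2 α)} (h : s ⊆ t)
    (hs : HasCopy F s) : HasCopy F t := by
  obtain ⟨f, hf⟩ := hs
  exact ⟨f, fun a b hab => h (hf a b hab)⟩

theorem aliceWins_of_W {N : ℕ} {β : Type*} (F : SimpleGraph β) (e0 : Cell N)
    (h0 : ¬ HasCopy F (edge (N := N) '' ((∅ : Finset (Cell N)) : Set (Cell N))))
    (hW : W (fun B : Finset (Cell N) => HasCopy F (edge '' (B : Set (Cell N)))) ∅ ∅) :
    AliceWins F (completeBipartiteGraph (Fin N) (Fin N)) := by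
  classical
  set Q : Finset (Cell N) → Prop := fun B => HasCopy F (edge '' (B : Set (Cell N))) with hQ
  set G := completeBipartiteGraph (Fin N) (Fin N) with hG
  have hfin : G.edgeSet.Finite := Set.toFinite _
  refine ⟨strat Q e0, strat_valid Q e0, fun τ hτ => ?_⟩
  set σ := strat Q e0 with hσ
  have hσv : σ.Valid G := strat_valid Q e0
  have key : ∀ d j : ℕ, G.edgeSet.ncard ≤ 2 * j + d → 2 * j ≤ G.edgeSet.ncard →
      W Q (blues (hist σ τ (2 * j))) (reds (hist σ τ (2 * j))) →
      ¬ Q (reds (hist σ τ (2 * j))) →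
      ∃ k : ℕ, 2 * k + 1 ≤ G.edgeSet.ncard ∧
      HasCopy F {e | ∃ i ≤ k, e = move σ τ (2 * i)} ∧
      ¬ HasCopy F {e | ∃ i < k, e = move σ τ (2 * i + 1)} := by
    intro d
    induction d using Nat.strong_induction_on with
    | _ d ih =>
    intro j hd hj hw hr
    have hex := hw.good
    set e := hex.choose with he
    have hgood : Good Q (blues (hist σ τ (2 * j))) (reds (hist σ τ (2 * j))) e := hex.choose_spec
    have hmv : move σ τ (2 * j) = edge e := by
      unfold move
      rw [if_pos (by omega)]
      exact strat_good Q e0 _ hex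
    obtain ⟨g1, g2, g3⟩ := hgood
    obtain ⟨i1, i2⟩ := hist_inv hσv hτ (2 * j) hj
    have hnot := not_mem_of _ _ g1 g2
    have hlen : 2 * j + 1 ≤ G.edgeSet.ncard := by
      have := length_le hfin (edge e :: hist σ τ (2 * j)) (List.nodup_cons.2 ⟨hnot, i1⟩) (by
        intro x hx
        rcases List.mem_cons.1 hx with rfl | hx
        · exact edge_mem _
        · exact i2 x hx)
      simpa [hist_length] using this
    have hb := blues_succ σ τ j e hmv
    by_cases hq : Q (insert e (blues (hist σ τ (2 * j))))
    · refine ⟨j, hlen, ?_, ?_⟩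
      · refine hasCopy_mono ?_ hq
        rintro _ ⟨c, hc, rfl⟩
        rw [mem_coe, ← hb] at hc
        simp only [blues, mem_filter, mem_univ, true_and] at hc
        obtain ⟨i, hi⟩ := hc
        have hlt : 2 * i < 2 * (j + 1) := by
          by_contra hcon
          rw [List.getElem?_eq_none (by rw [hist_length]; omega)] at hi
          simp at hi
        rw [hist_get _ _ _ _ hlt] at hi
        exact ⟨i, by omega, (Option.some.inj hi).symm⟩
      · intro hcon
        apply hr
        refine hasCopy_mono ?_ hcon
        rintro x ⟨i, hi, rfl⟩
        have hx := i2 (move σ τ (2 * i + 1)) ((mem_hist _ _ _ _).2 ⟨2 * i + 1, by omega, rfl⟩)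
        obtain ⟨c, hc⟩ := exists_edge _ hx
        refine ⟨c, ?_, hc.symm⟩
        rw [mem_coe]
        simp only [reds, mem_filter, mem_univ, true_and]
        exact ⟨i, by rw [hist_get _ _ _ _ (by omega), hc]⟩
    · obtain ⟨⟨f0, hf1, hf2⟩, hall⟩ := g3.resolve_left hq
      have hlen2 : 2 * j + 2 ≤ G.edgeSet.ncard := by
        have hn0 : edge f0 ∉ hist σ τ (2 * j) := not_mem_of _ _ (fun h => hf1 (mem_insert_of_mem h)) hf2
        have := length_le hfin (edge f0 :: edge e :: hist σ τ (2 * j)) (by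
          rw [List.nodup_cons, List.nodup_cons]
          refine ⟨?_, hnot, i1⟩
          intro hx
          rcases List.mem_cons.1 hx with hx | hx
          · exact hf1 (by rw [edge_inj hx]; exact mem_insert_self _ _)
          · exact hn0 hx) (by
          intro x hx
          rcases List.mem_cons.1 hx with rfl | hx
          · exact edge_mem _
          rcases List.mem_cons.1 hx with rfl | hx
          · exact edge_mem _
          · exact i2 x hx)
        simp only [List.length_cons, hist_length] at this
        omega
      obtain ⟨j1, j2⟩ := hist_inv hσv hτ (2 * j + 2) hlen2
      have hx := j2 (move σ τ (2 * j + 1)) ((mem_hist _ _ _ _).2 ⟨2 * j + 1, by omega, rfl⟩)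
      obtain ⟨c, hc⟩ := exists_edge _ hx
      have hrs := reds_succ σ τ j c hc
      have hnm : edge c ∉ hist σ τ (2 * j + 1) := by
        rw [hist_succ, List.nodup_append] at j1
        intro hm
        exact j1.2.2 _ hm _ (by rw [hc]; simp) rfl
      have hc1 : c ∉ insert e (blues (hist σ τ (2 * j))) := by
        intro hm
        apply hnm
        rw [mem_hist]
        rcases mem_insert.1 hm with rfl | hm
        · exact ⟨2 * j, by omega, hmv.symm⟩
        · simp only [blues, mem_filter, mem_univ, true_and] at hm
          obtain ⟨i, hi⟩ := hm
          have := (mem_hist σ τ (2 * j) (edge c)).1 (List.mem_of_getElem? hi)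
          obtain ⟨i', h1, h2⟩ := this
          exact ⟨i', by omega, h2⟩
      have hc2 : c ∉ reds (hist σ τ (2 * j)) := by
        intro hm
        apply hnm
        rw [mem_hist]
        simp only [reds, mem_filter, mem_univ, true_and] at hm
        obtain ⟨i, hi⟩ := hm
        have := (mem_hist σ τ (2 * j) (edge c)).1 (List.mem_of_getElem? hi)
        obtain ⟨i', h1, h2⟩ := this
        exact ⟨i', by omega, h2⟩
      obtain ⟨k1, k2⟩ := hall c hc1 hc2
      exact ih (d - 2) (by omega) (j + 1) (by omega) (by omega)
        (by rw [hb, hrs]; exact k2) (by rw [hrs]; exact k1)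
  have hb0 : blues (hist σ τ (2 * 0)) = ∅ := by simp [blues, hist]
  have hr0 : reds (hist σ τ (2 * 0)) = ∅ := by simp [reds, hist]
  exact key G.edgeSet.ncard 0 (by omega) (by omega) (by rw [hb0, hr0]; exact hW)
    (by rw [hr0]; exact h0)

end SMG

open AchievementGame

namespace SMG
open Finset

set_option linter.unusedSimpArgs false

/-- A copy of the star-matching with the center of the star in a row. -/
def RowCopy (m n : ℕ) {N : ℕ} (B : Finset (Cell N)) : Prop :=
  ∃ (v : Fin N) (S : Finset (Fin N)) (D : Finset (Cell N)), S.card = m ∧ D.card = n ∧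
    (∀ s ∈ S, (v, s) ∈ B) ∧ D ⊆ B ∧ (∀ d ∈ D, d.1 ≠ v ∧ d.2 ∉ S) ∧
    (∀ d ∈ D, ∀ d' ∈ D, d.1 = d'.1 → d = d') ∧ (∀ d ∈ D, ∀ d' ∈ D, d.2 = d'.2 → d = d')

def sw {N : ℕ} (B : Finset (Cell N)) : Finset (Cell N) := B.image (Equiv.prodComm _ _)

theorem mem_sw {N : ℕ} {B : Finset (Cell N)} {c : Cell N} : c ∈ sw B ↔ (c.2, c.1) ∈ B := by
  simp only [sw, mem_image]
  constructor
  · rintro ⟨a, ha, rfl⟩; exact ha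
  · intro h; exact ⟨_, h, rfl⟩

theorem sw_sw {N : ℕ} (B : Finset (Cell N)) : sw (sw B) = B := by
  ext c; rw [mem_sw, mem_sw]

theorem card_sw {N : ℕ} (B : Finset (Cell N)) : (sw B).card = B.card :=
  card_image_of_injective _ (Equiv.injective _)

def P (m n : ℕ) {N : ℕ} (B : Finset (Cell N)) : Prop := RowCopy m n B ∨ RowCopy m n (sw B)

theorem P_sw {m n N : ℕ} (B : Finset (Cell N)) : P m n (sw B) ↔ P m n B := by
  unfold P; rw [sw_sw]; exact or_comm

theorem W_sw {m n N : ℕ} {B R : Finset (Cell N)} (h : W (P m n) (sw B) (sw R)) :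
    W (P m n) B R := by
  have := W.map (Equiv.prodComm (Fin N) (Fin N)) (fun B h => (P_sw B).2 h)
    (fun B h => (P_sw B).1 h) h
  change W (P m n) (sw (sw B)) (sw (sw R)) at this
  rwa [sw_sw, sw_sw] at this

theorem adj_star (m n : ℕ) (i : Fin m) :
    (starMatching m n).Adj (Sum.inl 0) (Sum.inl i.succ) := by
  rw [starMatching, SimpleGraph.fromRel_adj]
  refine ⟨?_, Or.inl (Or.inl ⟨rfl, _, rfl⟩)⟩
  intro h
  exact (Fin.succ_ne_zero i) (Sum.inl.inj h).symm

theorem adj_match (m n : ℕ) (i : Fin n) :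
    (starMatching m n).Adj (Sum.inr (Sum.inl i)) (Sum.inr (Sum.inr i)) := by
  simp only [starMatching, SimpleGraph.fromRel_adj]
  exact ⟨by simp, Or.inl (Or.inr ⟨i, rfl, rfl⟩)⟩

theorem adj_cases (m n : ℕ) (S : Fin (m + 1) ⊕ (Fin n ⊕ Fin n) → Fin (m + 1) ⊕ (Fin n ⊕ Fin n) → Prop)
    (hs : ∀ a b, S a b → S b a) (h1 : ∀ i : Fin m, S (Sum.inl 0) (Sum.inl i.succ))
    (h2 : ∀ i, S (Sum.inr (Sum.inl i)) (Sum.inr (Sum.inr i))) (a b) 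
    (h : (starMatching m n).Adj a b) : S a b := by
  have key : ∀ a b, a ≠ b → ((a = Sum.inl 0 ∧ ∃ i, b = Sum.inl i) ∨
    (∃ i, a = Sum.inr (Sum.inl i) ∧ b = Sum.inr (Sum.inr i))) → S a b := by
    rintro a b hab (⟨rfl, i, rfl⟩ | ⟨i, rfl, rfl⟩)
    · have : i ≠ 0 := fun h => hab (by rw [h])
      obtain ⟨j, rfl⟩ := Fin.exists_succ_eq.2 this
      exact h1 j
    · exact h2 i
  simp only [starMatching, SimpleGraph.fromRel_adj] at h
  rcases h with ⟨hab, h | h⟩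
  · exact key a b hab h
  · exact hs _ _ (key b a hab.symm h)

theorem hasCopy_of_row {m n N : ℕ} {B : Finset (Cell N)} (h : RowCopy m n B) :
    HasCopy (starMatching m n) (edge '' (B : Set (Cell N))) := by
  obtain ⟨v, S, D, hS, hD, h1, h2, h3, h4, h5⟩ := h
  have eS : Fin m ≃ S := (S.equivFinOfCardEq hS).symm
  have eD : Fin n ≃ D := (D.equivFinOfCardEq hD).symm
  let f : Fin (m + 1) ⊕ (Fin n ⊕ Fin n) → Fin N ⊕ Fin N := fun x => match x with
    | Sum.inl i => Fin.cases (Sum.inl v) (fun j => Sum.inr (eS j).1) i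
    | Sum.inr (Sum.inl i) => Sum.inl (eD i).1.1
    | Sum.inr (Sum.inr i) => Sum.inr (eD i).1.2
  have f0 : f (Sum.inl 0) = Sum.inl v := rfl
  have f1 : ∀ j, f (Sum.inl (Fin.succ j)) = Sum.inr (eS j).1 := fun j => rfl
  have f2 : ∀ i, f (Sum.inr (Sum.inl i)) = Sum.inl (eD i).1.1 := fun j => rfl
  have f3 : ∀ i, f (Sum.inr (Sum.inr i)) = Sum.inr (eD i).1.2 := fun j => rfl
  have hf : Function.Injective f := by
    have hSj : ∀ i j, (eS i).1 = (eS j).1 → i = j := fun i j h => eS.injective (Subtype.ext h)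
    have hDj : ∀ i j, (eD i).1.1 = (eD j).1.1 → i = j := fun i j h =>
      eD.injective (Subtype.ext (h4 _ (eD i).2 _ (eD j).2 h))
    have hDj' : ∀ i j, (eD i).1.2 = (eD j).1.2 → i = j := fun i j h =>
      eD.injective (Subtype.ext (h5 _ (eD i).2 _ (eD j).2 h))
    have hv : ∀ i, (eD i).1.1 ≠ v := fun i => (h3 _ (eD i).2).1
    have hSD : ∀ i j, (eD i).1.2 ≠ (eS j).1 := fun i j h => (h3 _ (eD i).2).2 (h ▸ (eS j).2)
    rintro (a | a | a) (b | b | b)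
    · induction a using Fin.cases <;> induction b using Fin.cases <;> intro h <;>
        simp only [f0, f1, Sum.inl.injEq, Sum.inr.injEq, reduceCtorEq] at h ⊢
      rw [hSj _ _ h]
    · induction a using Fin.cases <;> intro h <;>
        simp only [f0, f1, f2, Sum.inl.injEq, Sum.inr.injEq, reduceCtorEq] at h ⊢
      exact hv _ h.symm
    · induction a using Fin.cases <;> intro h <;>
        simp only [f0, f1, f3, Sum.inl.injEq, Sum.inr.injEq, reduceCtorEq] at h ⊢
      exact hSD _ _ h.symm
    · induction b using Fin.cases <;> intro h <;>
        simp only [f0, f1, f2, Sum.inl.injEq, Sum.inr.injEq, reduceCtorEq] at h ⊢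
      exact hv _ h
    · intro h
      simp only [f2, Sum.inl.injEq] at h
      rw [hDj _ _ h]
    · intro h
      simp only [f2, f3, reduceCtorEq] at h
    · induction b using Fin.cases <;> intro h <;>
        simp only [f0, f1, f3, Sum.inl.injEq, Sum.inr.injEq, reduceCtorEq] at h ⊢
      exact hSD _ _ h
    · intro h
      simp only [f2, f3, reduceCtorEq] at h
    · intro h
      simp only [f3, Sum.inr.injEq] at h
      rw [hDj' _ _ h]
  refine ⟨⟨f, hf⟩, ?_⟩
  apply adj_cases
  · intro a b h
    rwa [Sym2.eq_swap]
  · intro i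
    exact ⟨(v, (eS i).1), h1 _ (eS i).2, rfl⟩
  · intro i
    exact ⟨(eD i).1, h2 (eD i).2, rfl⟩

theorem hasCopy_sw {m n N : ℕ} {B : Finset (Cell N)} 
    (h : HasCopy (starMatching m n) (edge '' (B : Set (Cell N)))) :
    HasCopy (starMatching m n) (edge '' (sw B : Set (Cell N))) := by
  obtain ⟨f, hf⟩ := h
  refine ⟨f.trans (Equiv.sumComm _ _).toEmbedding, fun a b hab => ?_⟩
  obtain ⟨c, hc, he⟩ := hf a b hab
  refine ⟨(c.2, c.1), mem_coe.2 (mem_sw.2 hc), ?_⟩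
  have := congrArg (Sym2.map Sum.swap) he
  simp only [edge, Sym2.map_mk, Sum.swap_inl, Sum.swap_inr] at this
  rw [edge, Sym2.eq_swap, this]
  rfl

theorem row_of_hasCopy {m n N : ℕ} {B : Finset (Cell N)}
    (f : (Fin (m + 1) ⊕ (Fin n ⊕ Fin n)) ↪ (Fin N ⊕ Fin N))
    (hf : ∀ a b, (starMatching m n).Adj a b → s(f a, f b) ∈ edge '' (B : Set (Cell N)))
    (v : Fin N) (hv : f (Sum.inl 0) = Sum.inl v) : RowCopy m n B := by
  have h1 : ∀ i : Fin m, ∃ c : Fin N, f (Sum.inl i.succ) = Sum.inr c ∧ (v, c) ∈ B := by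
    intro i
    obtain ⟨c, hc, he⟩ := hf _ _ (adj_star m n i)
    rw [hv] at he
    simp only [edge, Sym2.eq_iff, Sum.inl.injEq, reduceCtorEq, false_and, and_false, or_false] at he
    exact ⟨c.2, he.2.symm, by rw [← he.1]; exact hc⟩
  have h2 : ∀ i : Fin n, ∃ c ∈ B, edge c = s(f (Sum.inr (Sum.inl i)), f (Sum.inr (Sum.inr i))) := by
    intro i
    obtain ⟨c, hc, he⟩ := hf _ _ (adj_match m n i)
    exact ⟨c, hc, he⟩
  choose s hs1 hs2 using h1
  choose d hd1 hd2 using h2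
  have hd3 : ∀ i, ∃ x : Fin n ⊕ Fin n, Sum.elim id id x = i ∧ f (Sum.inr x) = Sum.inl (d i).1 := by
    intro i
    have := hd2 i
    simp only [edge, Sym2.eq_iff] at this
    rcases this with ⟨h, -⟩ | ⟨h, -⟩
    · exact ⟨Sum.inl i, rfl, h.symm⟩
    · exact ⟨Sum.inr i, rfl, h.symm⟩
  have hd4 : ∀ i, ∃ x : Fin n ⊕ Fin n, Sum.elim id id x = i ∧ f (Sum.inr x) = Sum.inr (d i).2 := by
    intro i
    have := hd2 i
    simp only [edge, Sym2.eq_iff] at this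
    rcases this with ⟨-, h⟩ | ⟨-, h⟩
    · exact ⟨Sum.inr i, rfl, h.symm⟩
    · exact ⟨Sum.inl i, rfl, h.symm⟩
  have hdi : ∀ i j, (d i).1 = (d j).1 → i = j := by
    intro i j h
    obtain ⟨x, hx1, hx2⟩ := hd3 i
    obtain ⟨y, hy1, hy2⟩ := hd3 j
    rw [h, ← hy2] at hx2
    rw [← hx1, ← hy1, Sum.inr.inj (f.injective hx2)]
  have hdj : ∀ i j, (d i).2 = (d j).2 → i = j := by
    intro i j h
    obtain ⟨x, hx1, hx2⟩ := hd4 i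
    obtain ⟨y, hy1, hy2⟩ := hd4 j
    rw [h, ← hy2] at hx2
    rw [← hx1, ← hy1, Sum.inr.inj (f.injective hx2)]
  have hsi : Function.Injective s := by
    intro i j h
    have : f (Sum.inl i.succ) = f (Sum.inl j.succ) := by rw [hs1, hs1, h]
    exact Fin.succ_injective _ (Sum.inl.inj (f.injective this))
  refine ⟨v, univ.image s, univ.image d, ?_, ?_, ?_, ?_, ?_, ?_, ?_⟩
  · rw [card_image_of_injective _ hsi]; simp
  · rw [card_image_of_injective _ (fun i j h => hdi i j (by rw [h]))]; simp
  · intro x hx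
    obtain ⟨i, -, rfl⟩ := mem_image.1 hx
    exact hs2 i
  · intro x hx
    obtain ⟨i, -, rfl⟩ := mem_image.1 hx
    exact hd1 i
  · intro x hx
    obtain ⟨i, -, rfl⟩ := mem_image.1 hx
    refine ⟨?_, ?_⟩
    · intro h
      obtain ⟨x, hx1, hx2⟩ := hd3 i
      rw [h, ← hv] at hx2
      exact absurd (f.injective hx2) (by simp)
    · intro h
      obtain ⟨j, -, hj⟩ := mem_image.1 h
      obtain ⟨x, hx1, hx2⟩ := hd4 i
      rw [← hj, ← hs1] at hx2
      exact absurd (f.injective hx2) (by simp)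
  · intro x hx y hy h
    obtain ⟨i, -, rfl⟩ := mem_image.1 hx
    obtain ⟨j, -, rfl⟩ := mem_image.1 hy
    rw [hdi i j h]
  · intro x hx y hy h
    obtain ⟨i, -, rfl⟩ := mem_image.1 hx
    obtain ⟨j, -, rfl⟩ := mem_image.1 hy
    rw [hdj i j h]

theorem hasCopy_iff {m n N : ℕ} (B : Finset (Cell N)) :
    HasCopy (starMatching m n) (edge '' (B : Set (Cell N))) ↔ P m n B := by
  constructor
  · rintro h
    obtain ⟨f, hf⟩ := h
    rcases hv : f (Sum.inl 0) with v | v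
    · exact Or.inl (row_of_hasCopy f hf v hv)
    · right
      have h' := hasCopy_sw ⟨f, hf⟩
      refine row_of_hasCopy (f.trans (Equiv.sumComm _ _).toEmbedding) ?_ v ?_
      · intro a b hab
        obtain ⟨c, hc, he⟩ := hf a b hab
        refine ⟨(c.2, c.1), mem_coe.2 (mem_sw.2 hc), ?_⟩
        have := congrArg (Sym2.map Sum.swap) he
        simp only [edge, Sym2.map_mk, Sum.swap_inl, Sum.swap_inr] at this
        rw [edge, Sym2.eq_swap, this]
        rfl
      · simp [hv]
  · rintro (h | h)
    · exact hasCopy_of_row h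
    · have := hasCopy_sw (hasCopy_of_row h)
      rwa [sw_sw] at this

/-- The columns of a row copy. -/
theorem RowCopy.cols {m n N : ℕ} {B : Finset (Cell N)} (h : RowCopy m n B) :
    ∃ (K : Finset (Cell N)), K ⊆ B ∧ K.card = m + n ∧
      (∀ d ∈ K, ∀ d' ∈ K, d.2 = d'.2 → d = d') ∧
      ∃ v : Fin N, m ≤ (B.filter (fun c => c.1 = v)).card ∧
        ∀ r, r ≠ v → (K.filter (fun c => c.1 = r)).card ≤ 1 := by
  obtain ⟨v, S, D, hS, hD, h1, h2, h3, h4, h5⟩ := h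
  have hinj : Function.Injective (fun s : Fin N => (v, s)) := fun a b h => (Prod.mk.inj h).2
  have hdis : Disjoint (S.image (fun s => (v, s))) D := by
    rw [disjoint_left]
    intro x hx hxD
    obtain ⟨s, hs, rfl⟩ := mem_image.1 hx
    exact (h3 _ hxD).1 rfl
  refine ⟨S.image (fun s => (v, s)) ∪ D, ?_, ?_, ?_, v, ?_, ?_⟩
  · intro x hx
    rcases mem_union.1 hx with hx | hx
    · obtain ⟨s, hs, rfl⟩ := mem_image.1 hx
      exact h1 s hs
    · exact h2 hx
  · rw [card_union_of_disjoint hdis, card_image_of_injective _ hinj, hS, hD]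
  · intro d hd d' hd' h
    rcases mem_union.1 hd with hd | hd <;> rcases mem_union.1 hd' with hd' | hd'
    · obtain ⟨s, hs, rfl⟩ := mem_image.1 hd
      obtain ⟨s', hs', rfl⟩ := mem_image.1 hd'
      simp only at h
      rw [h]
    · obtain ⟨s, hs, rfl⟩ := mem_image.1 hd
      exact absurd (h ▸ hs) (h3 _ hd').2
    · obtain ⟨s, hs, rfl⟩ := mem_image.1 hd'
      exact absurd (h ▸ hs) (h3 _ hd).2
    · exact h5 _ hd _ hd' h
  · rw [← hS, ← card_image_of_injective S hinj]
    apply card_le_card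
    intro x hx
    obtain ⟨s, hs, rfl⟩ := mem_image.1 hx
    exact mem_filter.2 ⟨h1 s hs, rfl⟩
  · intro r hr
    rw [card_le_one]
    intro a ha b hb
    rw [mem_filter, mem_union] at ha hb
    obtain ⟨ha | ha, ha'⟩ := ha
    · obtain ⟨s, hs, rfl⟩ := mem_image.1 ha
      exact absurd ha'.symm hr
    obtain ⟨hb | hb, hb'⟩ := hb
    · obtain ⟨s, hs, rfl⟩ := mem_image.1 hb
      exact absurd hb'.symm hr
    exact h4 _ ha _ hb (ha'.trans hb'.symm)

theorem RowCopy.le_N {m n N : ℕ} {B : Finset (Cell N)} (h : RowCopy m n B) : m + n ≤ N := by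
  obtain ⟨K, -, h2, h3, -⟩ := h.cols
  have : (K.image Prod.snd).card = K.card := card_image_of_injOn (fun a ha b hb h => h3 a ha b hb h)
  have h4 := card_le_univ (K.image Prod.snd)
  rw [this, h2, Fintype.card_fin] at h4
  exact h4

theorem P.le_N {m n N : ℕ} {B : Finset (Cell N)} (h : P m n B) : m + n ≤ N :=
  h.elim RowCopy.le_N RowCopy.le_N

theorem P.le_card {m n N : ℕ} {B : Finset (Cell N)} (h : P m n B) : m + n ≤ B.card := by
  rcases h with h | h
  · obtain ⟨K, h1, h2, -⟩ := h.cols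
    rw [← h2]; exact card_le_card h1
  · obtain ⟨K, h1, h2, -⟩ := h.cols
    rw [← h2, ← card_sw B]; exact card_le_card h1

theorem exists_valid {N : ℕ} (e0 : Cell N) :
    ∃ τ : Strategy (Fin N ⊕ Fin N), τ.Valid (completeBipartiteGraph (Fin N) (Fin N)) :=
  ⟨strat (fun _ => False) e0, strat_valid _ _⟩

theorem lower {m n N : ℕ}
    (h : AliceWins (starMatching m n) (completeBipartiteGraph (Fin N) (Fin N))) : m + n ≤ N := by
  classical
  obtain ⟨σ, hσ, h⟩ := h
  rcases Nat.eq_zero_or_pos N with rfl | hN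
  · exfalso
    have x := σ []
    induction x using Sym2.ind with
    | _ x y => rcases x with x | x <;> exact x.elim0
  obtain ⟨τ, hτ⟩ := exists_valid (N := N) (⟨0, hN⟩, ⟨0, hN⟩)
  obtain ⟨k, hk, hc, -⟩ := h τ hτ
  obtain ⟨-, hi⟩ := hist_inv hσ hτ (2 * k + 1) hk
  have : HasCopy (starMatching m n) (edge '' ((univ : Finset (Cell N)) : Set (Cell N))) := by
    refine hasCopy_mono ?_ hc
    rintro e ⟨i, hi', rfl⟩
    obtain ⟨c, hc⟩ := exists_edge _ (hi _ ((mem_hist _ _ _ _).2 ⟨2 * i, by omega, rfl⟩))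
    exact ⟨c, by simp, hc.symm⟩
  exact ((hasCopy_iff _).1 this).le_N

theorem upper_of_W {m n N : ℕ} (hN : 0 < N) (hm : 2 ≤ m) (h : W (P m n (N := N)) ∅ ∅) :
    AliceWins (starMatching m n) (completeBipartiteGraph (Fin N) (Fin N)) := by
  have hQ : (fun B : Finset (Cell N) => HasCopy (starMatching m n) (edge '' (B : Set (Cell N))))
      = P m n := by
    funext B; exact propext (hasCopy_iff B)
  refine aliceWins_of_W _ (⟨0, hN⟩, ⟨0, hN⟩) ?_ (by rw [hQ]; exact h)
  rw [hasCopy_iff]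
  intro h
  have := h.le_card
  simp at this
  omega

end SMG

open AchievementGame

namespace SMG
open Finset

theorem filt {C : Type} [DecidableEq C] {R R' : Finset C} (h : R ⊆ R')
    (hc : R'.card ≤ R.card + 1) (q : C → Prop) [DecidablePred q] :
    (R'.filter q).card ≤ (R.filter q).card + 1 := by
  have h1 : R'.filter q ⊆ R.filter q ∪ (R' \ R) := by
    intro x hx
    rw [mem_filter] at hx
    rw [mem_union, mem_filter, mem_sdiff]
    by_cases hR : x ∈ R
    · exact Or.inl ⟨hR, hx.2⟩
    · exact Or.inr ⟨hx.1, hR⟩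
  have h2 := card_le_card h1
  have h3 := card_union_le (R.filter q) (R' \ R)
  have h4 := card_sdiff_of_subset h
  omega

theorem exists_not_mem_of_card_lt {N : ℕ} (s : Finset (Fin N)) (h : s.card < N) :
    ∃ x, x ∉ s := by
  by_contra hcon
  push Not at hcon
  have : s = univ := eq_univ_iff_forall.2 hcon
  rw [this] at h
  simp at h

theorem residual {m n N : ℕ} (hN : N = m + n) (hm : 2 ≤ m) : ∀ (c : ℕ) (B R : Finset (Cell N))
    (v : Fin N) (S U : Finset (Fin N)) (D : Finset (Cell N)),
    U.card = c → 1 ≤ c → S.card = m → D.card + c = n → (∀ s ∈ S, (v, s) ∈ B) → D ⊆ B →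
    (∀ d ∈ D, d.1 ≠ v ∧ d.2 ∉ S ∧ d.2 ∉ U) →
    (∀ d ∈ D, ∀ d' ∈ D, d.1 = d'.1 → d = d') → (∀ d ∈ D, ∀ d' ∈ D, d.2 = d'.2 → d = d') →
    (∀ u ∈ U, u ∉ S) → (∀ b ∈ B, b.2 ∉ U) → Disjoint B R →
    (R.filter (fun x => x.2 ∈ U ∧ x.1 ≠ v)).card + 1 ≤ m →
    (R.filter (fun x => x.2 ∈ U ∧ x.1 ≠ v)).card ≤ c + 1 →
    (∀ R', R ⊆ R' → R'.card + 1 ≤ R.card + c → Disjoint B R' → ¬ P m n R') →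
    W (P m n) B R := by
  intro c
  induction c with
  | zero => intro B R v S U D _ h; omega
  | succ c ih =>
  intro B R v S U D hU _ hS hD hSB hDB hDd hD1 hD2 hUS hBU hBR hr1 hr2 hNB
  set Rf := R.filter (fun x => x.2 ∈ U ∧ x.1 ≠ v) with hRf
  have hUne : U.Nonempty := by rw [← card_pos]; omega
  obtain ⟨u, huU, humax⟩ := exists_max_image U (fun u => (Rf.filter (fun x => x.2 = u)).card) hUne
  set ru := (Rf.filter (fun x => x.2 = u)).card with hru
  have hruR : ru ≤ Rf.card := card_filter_le _ _
  -- choose the row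
  obtain ⟨r, hr⟩ := exists_not_mem_of_card_lt
    (insert v (D.image Prod.fst ∪ (Rf.filter (fun x => x.2 = u)).image Prod.fst)) (by
      have a1 := card_insert_le v (D.image Prod.fst ∪ (Rf.filter (fun x => x.2 = u)).image Prod.fst)
      have a2 := card_union_le (D.image Prod.fst) ((Rf.filter (fun x => x.2 = u)).image Prod.fst)
      have a3 : (D.image Prod.fst).card ≤ D.card := card_image_le
      have a4 : ((Rf.filter (fun x => x.2 = u)).image Prod.fst).card ≤ ru := card_image_le
      omega)
  simp only [mem_insert, mem_union, not_or] at hr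
  obtain ⟨hrv, hrD, hrR⟩ := hr
  have heB : (r, u) ∉ B := fun h => hBU _ h huU
  have heR : (r, u) ∉ R := by
    intro h
    apply hrR
    refine mem_image.2 ⟨(r, u), ?_, rfl⟩
    rw [mem_filter, hRf, mem_filter]
    exact ⟨⟨h, huU, hrv⟩, rfl⟩
  have heD : (r, u) ∉ D := fun h => heB (hDB h)
  have hcard : (insert (r, u) D).card = D.card + 1 := card_insert_of_notMem heD
  have k1 : ∀ d ∈ insert (r, u) D, d.1 ≠ v ∧ d.2 ∉ S ∧ d.2 ∉ U.erase u := by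
    intro d hd
    rcases mem_insert.1 hd with rfl | hd
    · exact ⟨hrv, hUS u huU, by simp⟩
    · obtain ⟨a, b, c⟩ := hDd d hd
      exact ⟨a, b, fun h => c (mem_of_mem_erase h)⟩
  have k2 : ∀ d ∈ insert (r, u) D, ∀ d' ∈ insert (r, u) D, d.1 = d'.1 → d = d' := by
    intro d hd d' hd' h
    rcases mem_insert.1 hd with rfl | hd <;> rcases mem_insert.1 hd' with rfl | hd'
    · rfl
    · exact absurd (mem_image.2 ⟨d', hd', h.symm⟩) hrD
    · exact absurd (mem_image.2 ⟨d, hd, h⟩) hrD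
    · exact hD1 d hd d' hd' h
  have k3 : ∀ d ∈ insert (r, u) D, ∀ d' ∈ insert (r, u) D, d.2 = d'.2 → d = d' := by
    intro d hd d' hd' h
    rcases mem_insert.1 hd with rfl | hd <;> rcases mem_insert.1 hd' with rfl | hd'
    · rfl
    · exact absurd (h ▸ huU) (hDd d' hd').2.2
    · exact absurd (h ▸ huU) (hDd d hd).2.2
    · exact hD2 d hd d' hd' h
  by_cases hc : c = 0
  · subst hc
    refine W.win _ _ (r, u) heB heR (Or.inl ⟨v, S, insert (r, u) D, hS, by omega, ?_, ?_, ?_, k2, k3⟩)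
    · intro s hs; exact mem_insert_of_mem (hSB s hs)
    · exact insert_subset_insert _ hDB
    · intro d hd; exact ⟨(k1 d hd).1, (k1 d hd).2.1⟩
  -- counting
  have hsum : Rf.card ≤ ru * (c + 1) := by
    rw [← hU]
    apply card_le_mul_card_image_of_maps_to (f := Prod.snd)
    · intro x hx
      rw [hRf, mem_filter] at hx
      exact hx.2.1
    · intro b hb
      exact humax b hb
  have hsplit : (R.filter (fun x => x.2 ∈ U.erase u ∧ x.1 ≠ v)).card + ru = Rf.card := by
    have h1 := card_filter_add_card_filter_not (s := Rf) (fun x => x.2 = u)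
    have h2 : Rf.filter (fun x => ¬ x.2 = u) = R.filter (fun x => x.2 ∈ U.erase u ∧ x.1 ≠ v) := by
      ext x
      simp only [hRf, mem_filter, mem_erase]
      tauto
    rw [h2] at h1
    omega
  have hfin : (R.filter (fun x => x.2 ∈ U.erase u ∧ x.1 ≠ v)).card + 2 ≤ m ∧
      (R.filter (fun x => x.2 ∈ U.erase u ∧ x.1 ≠ v)).card ≤ c := by
    rcases Nat.lt_or_ge ru 2 with h | h
    · rcases Nat.lt_or_ge ru 1 with h' | h'
      · have : ru = 0 := by omega
        rw [this] at hsum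
        omega
      · have : ru = 1 := by omega
        rw [this] at hsum
        omega
    · omega
  refine W.pass (r, u) heB heR ?_ hBR
  intro R' hRR' hcR' hdis
  have hdis' : Disjoint B R' := disjoint_of_subset_left (subset_insert _ _) hdis
  refine ⟨hNB R' hRR' (by omega) hdis', ?_⟩
  have hf := filt hRR' hcR' (fun x => x.2 ∈ U.erase u ∧ x.1 ≠ v)
  refine ih (insert (r, u) B) R' v S (U.erase u) (insert (r, u) D) ?_ (by omega) hS (by omega)
    ?_ ?_ k1 k2 k3 ?_ ?_ hdis (by omega) (by omega) ?_
  · rw [card_erase_of_mem huU]; omega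
  · intro s hs; exact mem_insert_of_mem (hSB s hs)
  · exact insert_subset_insert _ hDB
  · intro x hx; exact hUS x (mem_of_mem_erase hx)
  · intro b hb
    rcases mem_insert.1 hb with rfl | hb
    · simp
    · exact fun h => hBU b hb (mem_of_mem_erase h)
  · intro R'' h1 h2 h3
    exact hNB R'' (hRR'.trans h1) (by omega) (disjoint_of_subset_left (subset_insert _ _) h3)

theorem starL {m n N : ℕ} (hN : N = m + n) (hm : 2 ≤ m) (hn : 1 ≤ n) (hmn : m ≤ n + 2) :
    ∀ (k : ℕ) (B R : Finset (Cell N)) (v : Fin N) (S : Finset (Fin N)),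
    S.card + k = m → (∀ s ∈ S, (v, s) ∈ B) → (∀ b ∈ B, b.2 ∈ S) → Disjoint B R →
    (R.filter (fun x => x.1 = v)).card + 2 * m ≤ S.card + N + 1 →
    (R.filter (fun x => x.2 ∉ S ∧ x.1 ≠ v)).card + 1 ≤ S.card →
    (∀ R', R ⊆ R' → R'.card + 1 ≤ R.card + k + n → Disjoint B R' → ¬ P m n R') →
    W (P m n) B R := by
  intro k
  induction k with
  | zero =>
    intro B R v S hS hSB hBS hBR hx hr hNB
    have he : (R.filter (fun x => x.2 ∈ Sᶜ ∧ x.1 ≠ v)) = (R.filter (fun x => x.2 ∉ S ∧ x.1 ≠ v)) := by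
      simp only [mem_compl]
    refine residual hN hm n B R v S Sᶜ ∅ ?_ hn (by omega) (by simp) hSB (by simp) (by simp) (by simp)
      (by simp) (by simp) ?_ hBR (by rw [he]; omega) (by rw [he]; omega) ?_
    · rw [card_compl, Fintype.card_fin]; omega
    · intro b hb; simpa using hBS b hb
    · intro R' h1 h2 h3
      exact hNB R' h1 (by omega) h3
  | succ k ih =>
    intro B R v S hS hSB hBS hBR hx hr hNB
    obtain ⟨s, hs⟩ := exists_not_mem_of_card_lt
      (S ∪ (R.filter (fun x => x.1 = v)).image Prod.snd) (by
        have a1 := card_union_le S ((R.filter (fun x => x.1 = v)).image Prod.snd)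
        have a2 : ((R.filter (fun x => x.1 = v)).image Prod.snd).card ≤ _ := card_image_le
        omega)
    rw [mem_union, not_or] at hs
    obtain ⟨hsS, hsR⟩ := hs
    have heB : (v, s) ∉ B := fun h => hsS (hBS _ h)
    have heR : (v, s) ∉ R := fun h => hsR (mem_image.2 ⟨(v, s), mem_filter.2 ⟨h, rfl⟩, rfl⟩)
    have hc : (insert s S).card = S.card + 1 := card_insert_of_notMem hsS
    refine W.pass (v, s) heB heR ?_ hBR
    intro R' hRR' hcR' hdis
    have hdis' : Disjoint B R' := disjoint_of_subset_left (subset_insert _ _) hdis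
    refine ⟨hNB R' hRR' (by omega) hdis', ?_⟩
    have hf1 := filt hRR' hcR' (fun x => x.1 = v)
    have hf2 := filt hRR' hcR' (fun x => x.2 ∉ S ∧ x.1 ≠ v)
    have hf3 : (R'.filter (fun x => x.2 ∉ insert s S ∧ x.1 ≠ v)).card ≤
        (R'.filter (fun x => x.2 ∉ S ∧ x.1 ≠ v)).card := by
      apply card_le_card
      intro x hx
      simp only [mem_filter, mem_insert, not_or] at hx ⊢
      tauto
    refine ih _ R' v (insert s S) (by omega) ?_ ?_ hdis (by omega) (by omega) ?_
    · intro t ht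
      rcases mem_insert.1 ht with rfl | ht
      · exact mem_insert_self _ _
      · exact mem_insert_of_mem (hSB t ht)
    · intro b hb
      rcases mem_insert.1 hb with rfl | hb
      · exact mem_insert_self _ _
      · exact mem_insert_of_mem (hBS b hb)
    · intro R'' h1 h2 h3
      exact hNB R'' (hRR'.trans h1) (by omega) (disjoint_of_subset_left (subset_insert _ _) h3)

theorem second {m n N : ℕ} (hN : N = m + n) (hm : 2 ≤ m) (hn : 1 ≤ n) (hmn : m ≤ n + 2)
    (v s : Fin N) (R : Finset (Cell N)) (hR : R.card ≤ 1) (hd : Disjoint {(v, s)} R)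
    (h : m ≤ n + 1 ∨ ∀ x ∈ R, x.1 ≠ v) : W (P m n) {(v, s)} R := by
  obtain ⟨t, hts, htR, ht⟩ : ∃ t, t ≠ s ∧ (v, t) ∉ R ∧
      ∀ x ∈ R, x.2 ∉ ({t, s} : Finset (Fin N)) → x.1 = v := by
    by_cases hex : ∃ x ∈ R, x.1 ≠ v ∧ x.2 ≠ s
    · obtain ⟨x, hx, h1, h2⟩ := hex
      have huniq : ∀ y ∈ R, y = x := fun y hy => card_le_one.1 hR y hy x hx
      refine ⟨x.2, h2, ?_, ?_⟩
      · intro hm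
        exact h1 (by rw [← huniq _ hm])
      · intro y hy hy2
        rw [huniq y hy] at hy2
        simp at hy2
    · push Not at hex
      obtain ⟨t, ht⟩ := exists_not_mem_of_card_lt (insert s (R.image Prod.snd)) (by
        have a1 := card_insert_le s (R.image Prod.snd)
        have a2 : (R.image Prod.snd).card ≤ R.card := card_image_le
        omega)
      rw [mem_insert, not_or] at ht
      refine ⟨t, ht.1, fun h => ht.2 (mem_image.2 ⟨_, h, rfl⟩), ?_⟩
      intro y hy hy2
      by_contra hcon
      exact hy2 (by rw [hex y hy hcon]; simp)
  refine W.pass (v, t) (by simpa using hts) htR ?_ hd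
  intro R' hRR' hcR' hdis
  refine ⟨fun hP => by have := hP.le_card; omega, ?_⟩
  have hc : ({t, s} : Finset (Fin N)).card = 2 := card_pair hts
  have hf1 := filt hRR' hcR' (fun x => x.1 = v)
  have hf2 := filt hRR' hcR' (fun x => x.2 ∉ ({t, s} : Finset (Fin N)) ∧ x.1 ≠ v)
  have h0 : (R.filter (fun x => x.2 ∉ ({t, s} : Finset (Fin N)) ∧ x.1 ≠ v)).card = 0 := by
    rw [card_eq_zero, filter_eq_empty_iff]
    rintro x hx ⟨h1, h2⟩
    exact h2 (ht x hx h1)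
  refine starL hN hm hn hmn (m - 2) _ R' v {t, s} (by omega) ?_ ?_ hdis ?_ (by omega) ?_
  · intro x hx
    simp only [mem_insert, mem_singleton] at hx ⊢
    rcases hx with rfl | rfl <;> simp
  · intro x hx
    simp only [mem_insert, mem_singleton] at hx ⊢
    rcases hx with rfl | rfl <;> simp
  · rw [hc]
    rcases h with h | h
    · have : (R.filter (fun x => x.1 = v)).card ≤ R.card := card_filter_le _ _
      omega
    · have : (R.filter (fun x => x.1 = v)).card = 0 := by
        rw [card_eq_zero, filter_eq_empty_iff]
        exact fun x hx => h x hx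
      omega
  · intro R'' h1 h2 h3 hP
    have := hP.le_card
    omega

theorem col_card {N : ℕ} (Z : Finset (Cell N)) (v : Fin N) :
    (Z.filter (fun x => x.2 = v)).card ≤ N := by
  have h : ((Z.filter (fun x => x.2 = v)).image Prod.fst).card = (Z.filter (fun x => x.2 = v)).card := by
    apply card_image_of_injOn
    intro a ha b hb h
    have ha := (mem_filter.1 (mem_coe.1 ha)).2
    have hb := (mem_filter.1 (mem_coe.1 hb)).2
    exact Prod.ext h (ha.trans hb.symm)
  rw [← h]
  simpa using card_le_univ ((Z.filter (fun x => x.2 = v)).image Prod.fst)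

/-- If one column contains only `m - 1` red cells, a copy needs many other cells. -/
theorem col_block {m n N : ℕ} (hn : 1 ≤ m) (v : Fin N) (Z : Finset (Cell N)) (q : ℕ)
    (hq : (Z.filter (fun x => x.2 = v)).card = q) (hqm : q < m) (h : P m n Z) :
    m + n + q ≤ Z.card + 1 := by
  have key : ∀ K : Finset (Cell N), K ⊆ Z → K.card = m + n →
      (K.filter (fun x => x.2 = v)).card ≤ 1 → m + n + q ≤ Z.card + 1 := by
    intro K hK hKc h1
    have a1 := card_filter_add_card_filter_not (s := K) (fun x => x.2 = v)
    have a2 := card_filter_add_card_filter_not (s := Z) (fun x => x.2 = v)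
    have a3 : (K.filter (fun x => ¬ x.2 = v)).card ≤ (Z.filter (fun x => ¬ x.2 = v)).card :=
      card_le_card (filter_subset_filter _ hK)
    omega
  rcases h with h | h
  · obtain ⟨K, h1, h2, h3, -⟩ := h.cols
    refine key K h1 h2 ?_
    rw [card_le_one]
    intro a ha b hb
    rw [mem_filter] at ha hb
    exact h3 a ha.1 b hb.1 (ha.2.trans hb.2.symm)
  · obtain ⟨K, h1, h2, h3, v', h4, h5⟩ := h.cols
    have hs : ∀ Y : Finset (Cell N), (Y.filter (fun c => c.1 = v)).card =
        ((sw Y).filter (fun x => x.2 = v)).card := by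
      intro Y
      rw [← card_sw (Y.filter (fun c => c.1 = v))]
      congr 1
      ext x
      simp only [mem_sw, mem_filter]
    have hv : v ≠ v' := by
      rintro rfl
      rw [hs, sw_sw] at h4
      omega
    refine key (sw K) ?_ (by rw [card_sw, h2]) (by rw [← hs]; exact h5 v hv)
    intro x hx
    have := h1 (mem_sw.1 hx)
    simpa [mem_sw] using this

theorem fullRow {m n N : ℕ} (hN : N = m + n) (hn : 1 ≤ n) (hmn : m = n + 2) (v : Fin N) :
    ∀ (k : ℕ) (B R : Finset (Cell N)) (S : Finset (Fin N)),
    S.card + k + 1 = m → 1 ≤ S.card → (∀ s ∈ S, (v, s) ∈ B) → (∀ b ∈ B, b.1 = v ∧ b.2 ∈ S) →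
    Disjoint B R → (∀ x ∈ R, x.1 = v) → R.card ≤ S.card → W (P m n) B R := by
  intro k
  induction k with
  | zero =>
    intro B R S hS hS1 hSB hBS hBR hRv hRc
    have hro : (R.filter (fun x => x.1 = v)).card ≤ R.card := card_filter_le _ _
    have hrho : (R.filter (fun x => x.2 ∉ S ∧ x.1 ≠ v)).card = 0 := by
      rw [card_eq_zero, filter_eq_empty_iff]
      rintro x hx ⟨-, h⟩
      exact h (hRv x hx)
    by_cases hlt : R.card < S.card
    · refine starL hN (by omega) hn (by omega) 1 B R v S (by omega) hSB (fun b hb => (hBS b hb).2) hBR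
        (by omega) (by omega) ?_
      intro R' h1 h2 h3 hP
      have := hP.le_card
      omega
    · obtain ⟨s0, hs0⟩ : S.Nonempty := by rw [← card_pos]; omega
      apply W_sw
      have hdis : Disjoint (sw B) (sw R) := by
        rw [disjoint_left] at hBR ⊢
        intro x h1 h2
        exact hBR (mem_sw.1 h1) (mem_sw.1 h2)
      refine starL hN (by omega) hn (by omega) (m - 1) (sw B) (sw R) s0 {v} (by simp; omega) ?_ ?_ hdis
        ?_ ?_ ?_
      · intro t ht
        rw [mem_singleton] at ht
        subst ht
        exact mem_sw.2 (hSB _ hs0)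
      · intro b hb
        rw [mem_singleton]
        exact (hBS _ (mem_sw.1 hb)).1
      · have : ((sw R).filter (fun x => x.1 = s0)).card = 0 := by
          rw [card_eq_zero, filter_eq_empty_iff]
          intro x hx hx1
          have h2 := mem_sw.1 hx
          have h3 := hRv _ h2
          simp only at h3
          rw [h3, hx1] at h2
          exact disjoint_left.1 hBR (hSB _ hs0) h2
        rw [this, card_singleton]
        omega
      · have : ((sw R).filter (fun x => x.2 ∉ ({v} : Finset (Fin N)) ∧ x.1 ≠ s0)).card = 0 := by
          rw [card_eq_zero, filter_eq_empty_iff]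
          rintro x hx ⟨hx1, -⟩
          exact hx1 (mem_singleton.2 (hRv _ (mem_sw.1 hx)))
        rw [this, card_singleton]
      · intro R' h1 h2 h3 hP
        rw [card_sw] at h2
        have b1 : S.card ≤ (sw B).card := by
          rw [card_sw, ← card_image_of_injective S (fun a b h => (Prod.mk.inj h).2 :
            Function.Injective (fun s : Fin N => (v, s)))]
          apply card_le_card
          intro x hx
          obtain ⟨s, hs, rfl⟩ := mem_image.1 hx
          exact hSB s hs
        have b2 := col_card (sw B ∪ R') v
        rw [filter_union, card_union_of_disjoint (disjoint_filter_filter h3)] at b2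
        have b3 : (sw B).filter (fun x => x.2 = v) = sw B := by
          rw [filter_eq_self]
          intro x hx
          exact (hBS _ (mem_sw.1 hx)).1
        rw [b3] at b2
        have b4 : (sw R).card ≤ (R'.filter (fun x => x.2 = v)).card := by
          apply card_le_card
          intro x hx
          exact mem_filter.2 ⟨h1 hx, hRv _ (mem_sw.1 hx)⟩
        rw [card_sw] at b4
        have := col_block (by omega) v R' (m - 1) (by omega) (by omega) hP
        omega
  | succ k ih =>
    intro B R S hS hS1 hSB hBS hBR hRv hRc
    obtain ⟨t, ht⟩ := exists_not_mem_of_card_lt (S ∪ R.image Prod.snd) (by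
        have a1 := card_union_le S (R.image Prod.snd)
        have a2 : (R.image Prod.snd).card ≤ R.card := card_image_le
        omega)
    rw [mem_union, not_or] at ht
    have hc : (insert t S).card = S.card + 1 := card_insert_of_notMem ht.1
    refine W.pass (v, t) (fun h => ht.1 (hBS _ h).2) (fun h => ht.2 (mem_image.2 ⟨_, h, rfl⟩)) ?_ hBR
    intro R' hRR' hcR' hdis
    refine ⟨fun hP => by have := hP.le_card; omega, ?_⟩
    have g1 : ∀ s ∈ insert t S, (v, s) ∈ insert (v, t) B := by
      intro s hs
      rcases mem_insert.1 hs with rfl | hs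
      · exact mem_insert_self _ _
      · exact mem_insert_of_mem (hSB s hs)
    have g2 : ∀ b ∈ insert (v, t) B, b.1 = v ∧ b.2 ∈ insert t S := by
      intro b hb
      rcases mem_insert.1 hb with rfl | hb
      · exact ⟨rfl, mem_insert_self _ _⟩
      · exact ⟨(hBS b hb).1, mem_insert_of_mem (hBS b hb).2⟩
    by_cases hall : ∀ x ∈ R', x.1 = v
    · exact ih _ R' (insert t S) (by omega) (by omega) g1 g2 hdis hall (by omega)
    · push Not at hall
      obtain ⟨x, hx, hxv⟩ := hall
      have c1 : (R'.filter (fun x => x.1 = v)).card < R'.card := by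
        apply card_lt_card
        rw [filter_ssubset]
        exact ⟨x, hx, hxv⟩
      have c2 := filt hRR' hcR' (fun x => x.2 ∉ insert t S ∧ x.1 ≠ v)
      have c3 : (R.filter (fun x => x.2 ∉ insert t S ∧ x.1 ≠ v)).card = 0 := by
        rw [card_eq_zero, filter_eq_empty_iff]
        rintro y hy ⟨-, h⟩
        exact h (hRv y hy)
      refine starL hN (by omega) hn (by omega) (k + 1) _ R' v (insert t S) (by omega) g1
        (fun b hb => (g2 b hb).2) hdis (by omega) (by omega) ?_
      intro R'' h1 h2 h3 hP
      have := hP.le_card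
      omega

theorem main_W {m n N : ℕ} (hN : N = m + n) (hm : 2 ≤ m) (hn : 1 ≤ n) (hmn : m ≤ n + 2) :
    W (P m n (N := N)) ∅ ∅ := by
  have hpos : 0 < N := by omega
  set z : Fin N := ⟨0, hpos⟩
  refine W.pass (z, z) (by simp) (by simp) ?_ (by simp)
  intro R hR hc hdis
  rw [card_empty] at hc
  refine ⟨fun hP => by have := hP.le_card; omega, ?_⟩
  have he : insert (z, z) (∅ : Finset (Cell N)) = {(z, z)} := rfl
  rw [he] at hdis ⊢
  by_cases h : m ≤ n + 1 ∨ ∀ x ∈ R, x.1 ≠ z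
  · exact second hN hm hn hmn z z R (by omega) hdis h
  · push Not at h
    obtain ⟨h1, x, hx, hxz⟩ := h
    refine fullRow hN hn (by omega) z (m - 2) {(z, z)} R {z} (by simp; omega) (by simp) (by simp)
      (by simp) hdis ?_ (by simpa using hc)
    intro y hy
    rw [card_le_one.1 (by omega) y hy x hx, hxz]

end SMG

open AchievementGame
namespace SMG
open Finset

/-- Bit test. -/
def tb (b i : ℕ) : Bool := Nat.beq (Nat.land 1 (Nat.shiftRight b i)) 1

/-- The cell `(i, j)` of the five by five board is stored in bit `5 * i + j`. -/
def toSet (b : ℕ) : Finset (Cell 5) := univ.filter (fun p => tb b (5 * p.1.val + p.2.val) = true)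

def r5 : List ℕ := [0, 1, 2, 3, 4]

def idx (i j : ℕ) : ℕ := Nat.add (Nat.mul 5 i) j

/-- A necessary condition for having four cells in a line, for quick rejection. -/
def gate (b0 b1 b2 b3 : Bool) : Bool := (b0 || b1) && (b2 || b3)

/-- A bitmask contains a copy of the star with four leaves and one extra edge. -/
def hasF (b : ℕ) : Bool :=
  r5.any fun v =>
    (gate (tb b (idx v 0)) (tb b (idx v 1)) (tb b (idx v 2)) (tb b (idx v 3)) && r5.any fun c =>
      (r5.all fun j => Nat.beq j c || tb b (idx v j)) &&
      (r5.any fun i => !(Nat.beq i v) && tb b (idx i c))) ||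
    (gate (tb b (idx 0 v)) (tb b (idx 1 v)) (tb b (idx 2 v)) (tb b (idx 3 v)) && r5.any fun c =>
      (r5.all fun j => Nat.beq j c || tb b (idx j v)) &&
      (r5.any fun i => !(Nat.beq i v) && tb b (idx c i)))

def setb (b i : ℕ) : ℕ := Nat.lor b (Nat.shiftLeft 1 i)

def cells : List ℕ :=
  [0, 1, 2, 3, 4, 5, 6, 7, 8, 9, 10, 11, 12, 13, 14, 15, 16, 17, 18, 19, 20, 21, 22, 23, 24]

def free (B R i : ℕ) : Bool := !(tb (Nat.lor B R) i)

/-- Evaluate the first argument before applying the second one. -/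
def frc {α : Type} (x : ℕ) (g : ℕ → α) : α :=
  match x with
  | 0 => g 0
  | n + 1 => g (Nat.succ n)

theorem frc_eq {α : Type} (x : ℕ) (g : ℕ → α) : frc x g = g x := by cases x <;> rfl

/-- Weights of a line with given numbers of blue and red cells. -/
def wt (b r : ℕ) : ℕ :=
  (([[3, 5, 7, 20, 21], [12, 2, 6, 14, 0], [29, 15, 30, 0, 0], [30, 36, 0, 0, 0],
    [20, 32, 0, 0, 0]] : List (List ℕ)).getD b []).getD r 0

def bitsCol (b c : ℕ) : ℕ := Nat.mod (Nat.land (Nat.shiftRight b c) 1082401) 31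
def bitsRow (b v : ℕ) : ℕ :=
  Nat.land (Nat.shiftRight 112004398439102515831086157106144944400
    (Nat.mul 4 (Nat.land (Nat.shiftRight b (Nat.mul 5 v)) 31))) 7

def score (B R i : ℕ) : ℕ :=
  Nat.add (wt (bitsRow B (Nat.div i 5)) (bitsRow R (Nat.div i 5)))
    (wt (bitsCol B (Nat.mod i 5)) (bitsCol R (Nat.mod i 5)))

def pick (B R : ℕ) : List ℕ → ℕ → ℕ → ℕ
  | [], best, _ => best
  | i :: l, best, s =>
    bif free B R i then
      frc (Nat.succ (score B R i)) fun t => bif Nat.ble (Nat.succ s) t then pick B R l i t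
        else pick B R l best s
    else pick B R l best s

/-- The cells completing a copy in `B`. -/
def wins (B R : ℕ) : List ℕ := cells.filter fun e => free B R e && frc (setb B e) hasF

/-- Alice to move, with at most `t` red cells on the board; `k` is a bound for the depth. -/
def chk : ℕ → ℕ → ℕ → ℕ → Bool
  | 0, _, _, _ => false
  | k + 1, t, B, R =>
    (fun bw : List ℕ =>
      frc (bif bw.isEmpty then pick B R cells 25 0 else pick B R bw 25 0) fun e =>
        Nat.ble e 24 && free B R e && (bw.all fun f => Nat.beq f e) && frc (setb B e) fun B' =>
          (cells.any fun f => free B' R f) &&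
          (fun ws : List ℕ => cells.all fun f => !(free B' R f) ||
            (ws.any fun w => !(Nat.beq w f)) ||
            frc (setb R f) fun R' => chk k (Nat.succ t) B' R')
          (bif Nat.ble 3 t then wins B' R else []))
    (bif Nat.ble 4 t then wins R B else [])

theorem tb_eq (b i : ℕ) : tb b i = b.testBit i := by
  have h1 : Nat.land 1 (Nat.shiftRight b i) = 1 &&& (b >>> i) := rfl
  have h2 : (1 &&& (b >>> i)) = (b >>> i) % 2 := by rw [Nat.and_comm, Nat.and_one_is_mod]
  have h3 : b.testBit i = ((1 &&& (b >>> i)) != 0) := rfl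
  rw [h3]
  unfold tb
  rw [h1, h2]
  rcases Nat.mod_two_eq_zero_or_one (b >>> i) with h | h <;> rw [h] <;> rfl

theorem tb_setb (b i j : ℕ) : tb (setb b i) j = (tb b j || decide (i = j)) := by
  rw [tb_eq, tb_eq]
  have h1 : setb b i = b ||| (1 <<< i) := rfl
  rw [h1, Nat.testBit_or, Nat.one_shiftLeft, Nat.testBit_two_pow]

theorem free_iff (B R i : ℕ) : free B R i = true ↔ tb B i = false ∧ tb R i = false := by
  have h1 : Nat.lor B R = B ||| R := rfl
  unfold free
  rw [tb_eq, tb_eq, tb_eq, h1, Nat.testBit_or]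
  simp

theorem mem_toSet (b : ℕ) (p : Cell 5) : p ∈ toSet b ↔ tb b (5 * p.1.val + p.2.val) = true := by
  simp [toSet]

theorem toSet_setb (b : ℕ) (p : Cell 5) :
    toSet (setb b (5 * p.1.val + p.2.val)) = insert p (toSet b) := by
  ext q
  rw [mem_toSet, mem_insert, mem_toSet, tb_setb, Bool.or_eq_true, decide_eq_true_iff, or_comm]
  refine or_congr_left ⟨fun h => ?_, fun h => by rw [h]⟩
  have h1 := p.2.2
  have h2 := q.2.2
  refine Prod.ext (Fin.ext ?_) (Fin.ext ?_) <;> omega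

theorem mem_r5 (i : ℕ) : i ∈ r5 ↔ i < 5 := by
  simp only [r5, List.mem_cons, List.not_mem_nil, or_false]; omega

theorem mem_cells (i : ℕ) : i ∈ cells ↔ i < 25 := by
  simp only [cells, List.mem_cons, List.not_mem_nil, or_false]; omega

theorem exists_cell (e : ℕ) (he : e < 25) : ∃ p : Cell 5, e = 5 * p.1.val + p.2.val :=
  ⟨(⟨e / 5, by omega⟩, ⟨e % 5, by omega⟩), by simp only; omega⟩

theorem idx_lt (p : Cell 5) : 5 * p.1.val + p.2.val < 25 := by
  have h1 := p.1.2
  have h2 := p.2.2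
  omega

theorem rowCopy_iff (B : Finset (Cell 5)) : RowCopy 4 1 B ↔
    ∃ v c : Fin 5, (∀ j, j ≠ c → (v, j) ∈ B) ∧ ∃ i, i ≠ v ∧ (i, c) ∈ B := by
  constructor
  · rintro ⟨v, S, D, hS, hD, h1, h2, h3, -, -⟩
    obtain ⟨d, rfl⟩ := card_eq_one.1 hD
    obtain ⟨h4, h5⟩ := h3 d (mem_singleton_self d)
    refine ⟨v, d.2, fun j hj => h1 j ?_, d.1, h4, h2 (mem_singleton_self d)⟩
    have h6 : S = univ.erase d.2 := by
      apply eq_of_subset_of_card_le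
      · intro x hx
        rw [mem_erase]
        exact ⟨fun h => h5 (h ▸ hx), mem_univ _⟩
      · rw [card_erase_of_mem (mem_univ _), hS]; simp
    rw [h6, mem_erase]
    exact ⟨hj, mem_univ _⟩
  · rintro ⟨v, c, h1, i, h2, h3⟩
    refine ⟨v, univ.erase c, {(i, c)}, ?_, card_singleton _, ?_, ?_, ?_, ?_, ?_⟩
    · rw [card_erase_of_mem (mem_univ _)]; simp
    · intro s hs
      exact h1 s (ne_of_mem_erase hs)
    · intro d hd
      rw [mem_singleton.1 hd]; exact h3
    · intro d hd
      rw [mem_singleton.1 hd]; exact ⟨h2, fun h => ne_of_mem_erase h rfl⟩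
    · intro d hd d' hd' _
      rw [mem_singleton.1 hd, mem_singleton.1 hd']
    · intro d hd d' hd' _
      rw [mem_singleton.1 hd, mem_singleton.1 hd']

theorem gate_of (b : ℕ → Bool) (c : ℕ) (h : ∀ j < 5, j = c ∨ b j = true) :
    gate (b 0) (b 1) (b 2) (b 3) = true := by
  have h0 := h 0 (by omega)
  have h1 := h 1 (by omega)
  have h2 := h 2 (by omega)
  have h3 := h 3 (by omega)
  unfold gate
  rw [Bool.and_eq_true, Bool.or_eq_true, Bool.or_eq_true]
  refine ⟨?_, ?_⟩
  · rcases h0 with h0 | h0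
    · rcases h1 with h1 | h1
      · omega
      · exact Or.inr h1
    · exact Or.inl h0
  · rcases h2 with h2 | h2
    · rcases h3 with h3 | h3
      · omega
      · exact Or.inr h3
    · exact Or.inl h2

theorem hasF_nat (b : ℕ) : hasF b = true ↔ ∃ v < 5,
    (∃ c < 5, (∀ j < 5, j = c ∨ tb b (5 * v + j) = true) ∧ ∃ i < 5, i ≠ v ∧ tb b (5 * i + c) = true) ∨
    (∃ c < 5, (∀ j < 5, j = c ∨ tb b (5 * j + v) = true) ∧ ∃ i < 5, i ≠ v ∧ tb b (5 * c + i) = true) := by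
  have hi : ∀ i j, idx i j = 5 * i + j := fun _ _ => rfl
  unfold hasF
  simp only [List.any_eq_true, List.all_eq_true, Bool.and_eq_true, Bool.or_eq_true, mem_r5,
    Bool.not_eq_true', hi, Nat.beq_eq]
  have hb : ∀ i v : ℕ, Nat.beq i v = false ↔ i ≠ v := by
    intro i v
    rw [← Bool.not_eq_true, Nat.beq_eq]
  simp only [hb]
  refine exists_congr fun v => and_congr_right fun hv => or_congr ?_ ?_
  · refine ⟨fun h => h.2, fun h => ⟨?_, h⟩⟩
    obtain ⟨c, _, h, _⟩ := h
    exact gate_of (fun j => tb b (5 * v + j)) c h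
  · refine ⟨fun h => h.2, fun h => ⟨?_, h⟩⟩
    obtain ⟨c, _, h, _⟩ := h
    exact gate_of (fun j => tb b (5 * j + v)) c h

theorem hasF_iff (b : ℕ) : hasF b = true ↔ P 4 1 (toSet b) := by
  rw [hasF_nat, P, rowCopy_iff, rowCopy_iff]
  simp only [mem_sw, mem_toSet]
  constructor
  · rintro ⟨v, hv, ⟨c, hc, h1, i, hi, h2, h3⟩ | ⟨c, hc, h1, i, hi, h2, h3⟩⟩
    · refine Or.inl ⟨⟨v, hv⟩, ⟨c, hc⟩, fun j hj => ?_, ⟨i, hi⟩, ?_, h3⟩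
      · exact (h1 j j.2).resolve_left fun h => hj (Fin.ext h)
      · exact fun h => h2 (congrArg Fin.val h)
    · refine Or.inr ⟨⟨v, hv⟩, ⟨c, hc⟩, fun j hj => ?_, ⟨i, hi⟩, ?_, h3⟩
      · exact (h1 j j.2).resolve_left fun h => hj (Fin.ext h)
      · exact fun h => h2 (congrArg Fin.val h)
  · rintro (⟨v, c, h1, i, h2, h3⟩ | ⟨v, c, h1, i, h2, h3⟩)
    · refine ⟨v, v.2, Or.inl ⟨c, c.2, fun j hj => ?_, i, i.2, fun h => h2 (Fin.ext h), h3⟩⟩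
      by_cases h : j = c
      · exact Or.inl h
      · exact Or.inr (h1 ⟨j, hj⟩ fun h' => h (congrArg Fin.val h'))
    · refine ⟨v, v.2, Or.inr ⟨c, c.2, fun j hj => ?_, i, i.2, fun h => h2 (Fin.ext h), h3⟩⟩
      by_cases h : j = c
      · exact Or.inl h
      · exact Or.inr (h1 ⟨j, hj⟩ fun h' => h (congrArg Fin.val h'))

theorem mem_wins (B R : ℕ) (p : Cell 5) : 5 * p.1.val + p.2.val ∈ wins B R ↔
    p ∉ toSet B ∧ p ∉ toSet R ∧ P 4 1 (insert p (toSet B)) := by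
  unfold wins
  rw [List.mem_filter, mem_cells, Bool.and_eq_true, frc_eq, hasF_iff, toSet_setb, free_iff,
    mem_toSet, mem_toSet, Bool.not_eq_true, Bool.not_eq_true]
  have := idx_lt p
  tauto

theorem free_cell (B R : ℕ) (p : Cell 5) : free B R (5 * p.1.val + p.2.val) = true ↔
    p ∉ toSet B ∧ p ∉ toSet R := by
  rw [free_iff, mem_toSet, mem_toSet, Bool.not_eq_true, Bool.not_eq_true]

theorem chk_sound : ∀ (k t B R : ℕ), chk k t B R = true → (toSet R).card ≤ t →
    W (P 4 1) (toSet B) (toSet R) := by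
  intro k
  induction k with
  | zero => intro t B R h; simp [chk] at h
  | succ k ih =>
    intro t B R h ht
    simp only [chk, frc_eq] at h
    generalize hbw : (bif Nat.ble 4 t then wins R B else []) = bw at h
    generalize (bif bw.isEmpty then pick B R cells 25 0 else pick B R bw 25 0) = e at h
    simp only [Bool.and_eq_true] at h
    obtain ⟨⟨⟨he, hfr⟩, hall⟩, hf0, hrec⟩ := h
    obtain ⟨p, rfl⟩ := exists_cell e (by have := Nat.le_of_ble_eq_true he; omega)
    rw [free_cell] at hfr
    rw [List.any_eq_true] at hf0
    obtain ⟨f0, hf0, hf0'⟩ := hf0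
    obtain ⟨q0, rfl⟩ := exists_cell f0 ((mem_cells _).1 hf0)
    rw [free_cell, toSet_setb] at hf0'
    refine W.step _ _ p q0 hfr.1 hfr.2 hf0'.1 hf0'.2 fun q hq1 hq2 => ⟨fun hP => ?_, ?_⟩
    · by_cases h4 : 4 ≤ t
      · rw [Nat.ble_eq_true_of_le h4, cond_true] at hbw
        subst hbw
        rw [List.all_eq_true] at hall
        have h5 := hall _ ((mem_wins R B q).2 ⟨hq2, fun h => hq1 (mem_insert_of_mem h), hP⟩)
        rw [Nat.beq_eq] at h5
        apply hq1
        have h6 := p.2.2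
        have h7 := q.2.2
        rw [mem_insert]
        left
        refine Prod.ext (Fin.ext ?_) (Fin.ext ?_) <;> omega
      · have h5 := hP.le_card
        have h6 := card_insert_le q (toSet R)
        omega
    · rw [List.all_eq_true] at hrec
      have h1 := hrec _ ((mem_cells _).2 (idx_lt q))
      have h2 : free (setb B (5 * p.1.val + p.2.val)) R (5 * q.1.val + q.2.val) = true := by
        rw [free_cell, toSet_setb]; exact ⟨hq1, hq2⟩
      rw [h2] at h1
      simp only [Bool.not_true, Bool.false_or, Bool.or_eq_true] at h1
      rcases h1 with h1 | h1
      · rw [List.any_eq_true] at h1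
        obtain ⟨w, hw, hw'⟩ := h1
        have hw2 : w ∈ wins (setb B (5 * p.1.val + p.2.val)) R := by
          cases hb : Nat.ble 3 t
          · rw [hb] at hw; simp at hw
          · rw [hb] at hw; exact hw
        have hw3 : w < 25 := by
          unfold wins at hw2
          exact (mem_cells _).1 (List.mem_filter.1 hw2).1
        obtain ⟨x, rfl⟩ := exists_cell w hw3
        rw [mem_wins, toSet_setb] at hw2
        refine W.win _ _ x hw2.1 ?_ hw2.2.2
        rw [mem_insert]
        rintro (rfl | h)
        · simp at hw'
        · exact hw2.2.1 h
      · have h3 := ih _ _ _ h1 ?_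
        · rw [toSet_setb, toSet_setb] at h3
          exact h3
        · rw [toSet_setb]
          have h6 := card_insert_le q (toSet R)
          exact h6.trans (Nat.succ_le_succ ht)

theorem RowCopy.perm {m n N : ℕ} (σ τ : Equiv.Perm (Fin N)) {B : Finset (Cell N)}
    (h : RowCopy m n B) : RowCopy m n (B.image (Equiv.prodCongr σ τ)) := by
  obtain ⟨v, S, D, hS, hD, h1, h2, h3, h4, h5⟩ := h
  refine ⟨σ v, S.image τ, D.image (Equiv.prodCongr σ τ), ?_, ?_, ?_, image_subset_image h2, ?_, ?_, ?_⟩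
  · rw [card_image_of_injective _ τ.injective, hS]
  · rw [card_image_of_injective _ (Equiv.injective _), hD]
  · intro s hs
    obtain ⟨s, hs0, rfl⟩ := mem_image.1 hs
    exact mem_image.2 ⟨_, h1 s hs0, rfl⟩
  · intro d hd
    obtain ⟨d, hd0, rfl⟩ := mem_image.1 hd
    refine ⟨fun h => (h3 d hd0).1 (σ.injective h), fun h => ?_⟩
    obtain ⟨s, hs, h⟩ := mem_image.1 h
    exact (h3 d hd0).2 ((τ.injective h) ▸ hs)
  · intro d hd d' hd' h
    obtain ⟨d, hd0, rfl⟩ := mem_image.1 hd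
    obtain ⟨d', hd1, rfl⟩ := mem_image.1 hd'
    rw [h4 d hd0 d' hd1 (σ.injective h)]
  · intro d hd d' hd' h
    obtain ⟨d, hd0, rfl⟩ := mem_image.1 hd
    obtain ⟨d', hd1, rfl⟩ := mem_image.1 hd'
    rw [h5 d hd0 d' hd1 (τ.injective h)]

theorem sw_perm {N : ℕ} (σ τ : Equiv.Perm (Fin N)) (B : Finset (Cell N)) :
    sw (B.image (Equiv.prodCongr σ τ)) = (sw B).image (Equiv.prodCongr τ σ) := by
  unfold sw
  rw [image_image, image_image]
  rfl

theorem P_perm {m n N : ℕ} (σ τ : Equiv.Perm (Fin N)) {B : Finset (Cell N)} (h : P m n B) :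
    P m n (B.image (Equiv.prodCongr σ τ)) := by
  rcases h with h | h
  · exact Or.inl (h.perm σ τ)
  · refine Or.inr ?_
    rw [sw_perm]
    exact h.perm τ σ

theorem W_perm {m n N : ℕ} (σ τ : Equiv.Perm (Fin N)) {B R B' R' : Finset (Cell N)}
    (h : W (P m n) B R) (hB : B.image (Equiv.prodCongr σ τ) = B')
    (hR : R.image (Equiv.prodCongr σ τ) = R') : W (P m n) B' R' := by
  subst hB hR
  refine h.map _ (fun B h => P_perm σ τ h) fun B h => ?_
  have h1 := P_perm σ.symm τ.symm h
  rw [image_image] at h1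
  have h2 : (⇑(Equiv.prodCongr σ.symm τ.symm) ∘ ⇑(Equiv.prodCongr σ τ)) = id := by
    funext x
    exact (Equiv.prodCongr σ τ).symm_apply_apply x
  rw [h2, image_id] at h1
  exact h1

theorem start_ok : (chk 7 2 33 6 && chk 7 2 33 66 && chk 7 2 33 130 && chk 7 2 33 1026 &&
    chk 7 2 33 2050 && chk 7 2 33 4098) = true := by decide +kernel

theorem canon_aux (i j : Fin 5) (h : (i, j) ∈ ([(0, 2), (1, 1), (1, 2), (2, 0), (2, 1), (2, 2)] :
    List (Cell 5))) : W (P 4 1 (N := 5)) {(0, 0), (1, 0)} {(0, 1), (i, j)} := by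
  have hB : toSet 33 = {(0, 0), (1, 0)} := by decide
  have h0 := start_ok
  simp only [Bool.and_eq_true] at h0
  obtain ⟨⟨⟨⟨⟨h1, h2⟩, h3⟩, h4⟩, h5⟩, h6⟩ := h0
  rw [← hB]
  simp only [List.mem_cons, Prod.mk.injEq, List.not_mem_nil, or_false] at h
  rcases h with ⟨rfl, rfl⟩ | ⟨rfl, rfl⟩ | ⟨rfl, rfl⟩ | ⟨rfl, rfl⟩ | ⟨rfl, rfl⟩ | ⟨rfl, rfl⟩
  · rw [show ({(0, 1), (0, 2)} : Finset (Cell 5)) = toSet 6 by decide]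
    exact chk_sound _ _ _ _ h1 (by decide)
  · rw [show ({(0, 1), (1, 1)} : Finset (Cell 5)) = toSet 66 by decide]
    exact chk_sound _ _ _ _ h2 (by decide)
  · rw [show ({(0, 1), (1, 2)} : Finset (Cell 5)) = toSet 130 by decide]
    exact chk_sound _ _ _ _ h3 (by decide)
  · rw [show ({(0, 1), (2, 0)} : Finset (Cell 5)) = toSet 1026 by decide]
    exact chk_sound _ _ _ _ h4 (by decide)
  · rw [show ({(0, 1), (2, 1)} : Finset (Cell 5)) = toSet 2050 by decide]
    exact chk_sound _ _ _ _ h5 (by decide)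
  · rw [show ({(0, 1), (2, 2)} : Finset (Cell 5)) = toSet 4098 by decide]
    exact chk_sound _ _ _ _ h6 (by decide)

/-- Lines of index above two may be exchanged with the line of index two. -/
def red2 (i : Fin 5) : Fin 5 := if 2 ≤ i then 2 else i

def perm2 (i : Fin 5) : Equiv.Perm (Fin 5) := if 2 ≤ i then Equiv.swap 2 i else 1

theorem canon (f : Cell 5) (h1 : f ∉ ({(0, 0), (1, 0)} : Finset (Cell 5)))
    (h2 : f ∉ ({(0, 1)} : Finset (Cell 5))) :
    W (P 4 1 (N := 5)) {(0, 0), (1, 0)} {(0, 1), f} := by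
  obtain ⟨i, j⟩ := f
  refine W_perm (perm2 i) (perm2 j) (canon_aux (red2 i) (red2 j) ?_) ?_ ?_
  · revert i j; decide
  · clear h1 h2; revert i j; decide
  · clear h1 h2; revert i j; decide

theorem W_two (x : Cell 5) (hx : x = (0, 1) ∨ x = (1, 1)) :
    W (P 4 1 (N := 5)) {(0, 0)} {x} := by
  have hc : ∀ f : Cell 5, ¬ P 4 1 (insert f {x}) := by
    intro f h
    have h1 := h.le_card
    have h2 := card_insert_le f {x}
    rw [card_singleton] at h2
    omega
  have hX : ({(0, 0), (1, 0)} : Finset (Cell 5)) = insert (1, 0) {(0, 0)} := by decide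
  refine W.step _ _ (1, 0) (2, 2) (by decide) ?_ (by decide) ?_ fun f h1 h2 => ⟨hc f, ?_⟩
  · rcases hx with rfl | rfl <;> decide
  · rcases hx with rfl | rfl <;> decide
  · rcases hx with rfl | rfl
    · rw [← hX] at h1 ⊢
      rw [pair_comm f]
      exact canon f h1 h2
    · obtain ⟨i, j⟩ := f
      rw [← hX] at h1 ⊢
      refine W_perm (Equiv.swap 0 1) 1 (canon (Equiv.swap 0 1 i, j) ?_ ?_) ?_ ?_
      · revert i j; decide
      · revert i j; decide
      · decide
      · clear h1 h2; revert i j; decide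

theorem W_row (b : Fin 5) (hb : b ≠ 0) : W (P 4 1 (N := 5)) {(0, 0)} {(0, b)} := by
  refine W_perm 1 (Equiv.swap 1 b) (W_two (0, 1) (Or.inl rfl)) ?_ ?_
  · revert b; decide
  · revert b; decide

theorem W_four_one : W (P 4 1 (N := 5)) ∅ ∅ := by
  refine W.step _ _ (0, 0) (1, 1) (by decide) (by decide) (by decide) (by decide)
    fun f h1 _ => ⟨fun h => ?_, ?_⟩
  · have h2 := h.le_card
    rw [insert_empty_eq, card_singleton] at h2
    omega
  · obtain ⟨i, j⟩ := f
    rw [insert_empty_eq] at h1 ⊢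
    rw [insert_empty_eq]
    by_cases hi : i = 0
    · subst hi
      refine W_row j ?_
      rintro rfl
      exact h1 (mem_singleton_self _)
    · by_cases hj : j = 0
      · subst hj
        apply W_sw
        have h3 := W_row i hi
        rw [show sw ({(0, 0)} : Finset (Cell 5)) = {(0, 0)} by decide]
        have h4 : sw ({(i, 0)} : Finset (Cell 5)) = {(0, i)} := by
          clear h1 hi h3; revert i; decide
        rw [h4]
        exact h3
      · refine W_perm (Equiv.swap 1 i) (Equiv.swap 1 j) (W_two (1, 1) (Or.inr rfl)) ?_ ?_
        · clear h1; revert i j; decide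
        · clear h1; revert i j; decide

end SMG

/-- Let `m ≥ 2` and `n ≥ 1` be integers such that `m ≤ 4` or `n ≥ m − 2`. Then the
bipartite achievement number of the disjoint union of a star and a matching satisfies
`ba(K_{1,m} ∪ nK₂) = m + n`: the least `N` for which Alice has a winning strategy in
`(K_{1,m} ∪ nK₂, K_{N,N}, +)` is `m + n`. -/
theorem stmt18 (m n : ℕ) (hm : 2 ≤ m) (hn : 1 ≤ n) (h : m ≤ 4 ∨ m - 2 ≤ n) :
    IsLeast {N : ℕ | AliceWins (starMatching m n)
      (completeBipartiteGraph (Fin N) (Fin N))} (m + n) := by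
  refine ⟨?_, fun N hN => SMG.lower hN⟩
  by_cases hmn : m ≤ n + 2
  · exact SMG.upper_of_W (by omega) hm (SMG.main_W rfl hm hn hmn)
  · obtain rfl : m = 4 := by omega
    obtain rfl : n = 1 := by omega
    exact SMG.upper_of_W (by omega) hm SMG.W_four_one
end
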